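/- arXiv:math/0612178 — 2 statements merged into one kernel-verified Lean document; each statement's English description precedes it below -/
import Mathlib

section
/- If the group generated by an invertible automaton with 3 states over a 2-letter alphabet is a non-abelian free group, then it is a free group of rank 3. -/
/-- An invertible automaton over the two-letter alphabet `Bool`:
a set of states `Q`, a transition map and an output map such that each state
acts on the alphabet by a permutation. -/
structure BinAutomaton (Q : Type*) where
  trans : Q → Bool → Q
  out : Q → Bool → Bool
  out_bij : ∀ q, Function.Bijective (out q)

namespace BinAutomaton

variable {Q : Type*} (A : BinAutomaton Q)

/-- The action of a state on finite binary words: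
`q(xw) = ρ(q,x) · (τ(q,x))(w)`. -/
def act : Q → List Bool → List Bool
  | _, [] => []
  | q, x :: w => A.out q x :: act (A.trans q x) w

theorem act_injective (q : Q) : Function.Injective (A.act q) := by
  intro u
  induction u generalizing q with
  | nil =>
    intro v h
    cases v with
    | nil => rfl
    | cons y v => simp [act] at h
  | cons x u ih =>
    intro v h
    cases v with
    | nil => simp [act] at h
    | cons y v =>
      simp only [act, List.cons.injEq] at h
      obtain ⟨h1, h2⟩ := h
      obtain rfl : x = y := (A.out_bij q).1 h1
      rw [ih _ h2]

theorem act_surjective (q : Q) : Function.Surjective (A.act q) := by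
  intro v
  induction v generalizing q with
  | nil => exact ⟨[], rfl⟩
  | cons y v ih =>
    obtain ⟨x, hx⟩ := (A.out_bij q).2 y
    obtain ⟨w, hw⟩ := ih (A.trans q x)
    exact ⟨x :: w, by simp [act, hx, hw]⟩

/-- The tree automorphism defined by the state `q`. -/
noncomputable def perm (q : Q) : Equiv.Perm (List Bool) :=
  Equiv.ofBijective (A.act q) ⟨A.act_injective q, A.act_surjective q⟩

/-- The group generated by the automaton: the subgroup of the group of
bijections of the binary tree generated by the states. -/
noncomputable def autGroup : Subgroup (Equiv.Perm (List Bool)) :=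
  Subgroup.closure (Set.range A.perm)

end BinAutomaton

/-- Helper constructing a 3-state automaton from the sections at `0`, the
sections at `1`, and the activity of each state. -/
def mkAut3 (t0 t1 : Fin 3 → Fin 3) (actv : Fin 3 → Bool) : BinAutomaton (Fin 3) where
  trans q x := cond x (t1 q) (t0 q)
  out q x := xor (actv q) x
  out_bij q := by
    have h : ∀ b : Bool, Function.Bijective fun x => xor b x := by decide
    exact h (actv q)

namespace Aut3

/-- The three states. -/
inductive St : Type
  | a | b | c

/-- Boolean equality of states. -/
def St.eqb : St → St → Bool
  | .a, .a => true
  | .b, .b => true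
  | .c, .c => true
  | _, _ => false

theorem St.eqb_iff (p q : St) : St.eqb p q = true ↔ p = q := by
  cases p <;> cases q <;> simp [St.eqb]

instance : DecidableEq St := fun p q => decidable_of_iff _ (St.eqb_iff p q)

instance : Fintype St := ⟨{St.a, St.b, St.c}, by intro x; cases x <;> simp⟩

/-- Bounded universal quantification over states. -/
def allSt (f : St → Bool) : Bool := f .a && f .b && f .c

theorem allSt_iff (f : St → Bool) : allSt f = true ↔ ∀ q, f q = true := by
  constructor
  · intro h q
    simp only [allSt, Bool.and_eq_true] at h
    cases q
    · exact h.1.1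
    · exact h.1.2
    · exact h.2
  · intro h
    simp [allSt, h]

/-- A letter: a state together with a flag which is `true` for the inverse. -/
inductive Lt : Type
  | mk (q : St) (i : Bool)

/-- Boolean equality of letters. -/
def Lt.eqb : Lt → Lt → Bool
  | .mk q i, .mk p j => St.eqb q p && (i == j)

theorem Lt.eqb_iff (p q : Lt) : Lt.eqb p q = true ↔ p = q := by
  cases p; cases q; simp [Lt.eqb, St.eqb_iff]

/-- Inverse letter. -/
def Lt.inv : Lt → Lt
  | .mk q i => .mk q (!i)

/-- Words in the states and their inverses; the head acts first. -/
abbrev Wd := List Lt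

/-- Boolean equality of words. -/
def weqb : Wd → Wd → Bool
  | [], [] => true
  | l :: v, m :: w => Lt.eqb l m && weqb v w
  | _, _ => false

theorem weqb_iff (v w : Wd) : weqb v w = true ↔ v = w := by
  induction v generalizing w with
  | nil => cases w <;> simp [weqb]
  | cons l v ih => cases w <;> simp [weqb, Lt.eqb_iff, ih]

/-- Membership of a word in a list. -/
def wmem (w : Wd) : List Wd → Bool
  | [] => false
  | v :: S => weqb w v || wmem w S

theorem wmem_iff (w : Wd) (S : List Wd) : wmem w S = true ↔ w ∈ S := by
  induction S with
  | nil => simp [wmem]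
  | cons v S ih => simp [wmem, weqb_iff, ih]

/-- Evaluate a state before passing it on. -/
def forceS (q : St) (k : St → α) : α :=
  match q with
  | .a => k .a
  | .b => k .b
  | .c => k .c

@[simp] theorem forceS_eq (q : St) (k : St → α) : forceS q k = k q := by
  cases q <;> rfl

/-- Evaluate a letter before passing it on. -/
def forceL (l : Lt) (k : Lt → α) : α :=
  match l with
  | .mk q i => forceS q fun qq2 => match i with
    | true => k (.mk qq2 true)
    | false => k (.mk qq2 false)

@[simp] theorem forceL_eq (l : Lt) (k : Lt → α) : forceL l k = k l := by
  cases l with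
  | mk q i => cases i <;> simp [forceL]

/-- Evaluate a word before passing it on. -/
def forceW (w : Wd) (k : Wd → α) : α :=
  match w with
  | [] => k []
  | l :: v => forceL l fun ll2 => forceW v fun vv2 => k (ll2 :: vv2)

@[simp] theorem forceW_eq (w : Wd) (k : Wd → α) : forceW w k = k w := by
  induction w generalizing k with
  | nil => rfl
  | cons l v ih => simp [forceW, ih]

/-- Free reduction when adding a letter. -/
def rcons (l : Lt) (w : Wd) : Wd :=
  match w with
  | [] => [l]
  | m :: v => match Lt.eqb l m.inv with
    | true => v
    | false => l :: m :: v

/-- Combinatorial data of an automaton on the three states: activity and transitions. -/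
structure Dat where
  al : St → Bool
  t : Bool → St → St

/-- Output of a letter. -/
def Dat.lout (D : Dat) : Lt → Bool → Bool
  | .mk q _, x => xor (D.al q) x

/-- Section of a letter. -/
def Dat.lsec (D : Dat) : Lt → Bool → Lt
  | .mk q false, x => .mk (D.t x q) false
  | .mk q true, x => .mk (D.t (xor (D.al q) x) q) true

/-- Section of a word. -/
def Dat.sec (D : Dat) : Wd → Bool → Wd
  | [], _ => []
  | l :: w, x => match D.lout l x with
    | true => rcons (D.lsec l x) (D.sec w true)
    | false => rcons (D.lsec l x) (D.sec w false)

/-- The sum of a character over a word. -/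
def cnt (χ : St → Bool) : Wd → Bool
  | [] => false
  | .mk q _ :: w => xor (χ q) (cnt χ w)

/-- Search for a closed set of inactive words. -/
def Dat.triv (D : Dat) : Nat → List Wd → List Wd → Bool
  | _, _, [] => true
  | 0, _, _ :: _ => false
  | n + 1, S, w :: td => match wmem w S with
    | true => D.triv n S td
    | false => match cnt D.al w with
      | true => false
      | false => forceW (D.sec w false) fun v0 => forceW (D.sec w true) fun v1 =>
          D.triv n (w :: S) (v0 :: v1 :: td)

/-- Search for a witness of nontriviality of bounded depth. -/
def Dat.nontriv (D : Dat) : Nat → Wd → Bool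
  | 0, _ => false
  | n + 1, w => match cnt D.al w with
    | true => true
    | false => forceW (D.sec w false) fun v0 => match D.nontriv n v0 with
      | true => true
      | false => forceW (D.sec w true) fun v1 => D.nontriv n v1

/-- Product with free reduction. -/
def wmul : Wd → Wd → Wd
  | [], w => w
  | l :: v, w => rcons l (wmul v w)

/-- Inverse word. -/
def winv : Wd → Wd
  | [] => []
  | l :: v => wmul (winv v) [l.inv]

/-- Power of a word. -/
def wpow (w : Wd) : Nat → Wd
  | 0 => []
  | n + 1 => wmul w (wpow w n)

/-- Commutator. -/
def wcomm (v w : Wd) : Wd := wmul v (wmul w (wmul (winv v) (winv w)))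

/-- Conjugation by a state. -/
def wconj (q : St) (w : Wd) : Wd := wmul [.mk q false] (wmul w [.mk q true])

/-- Closedness test with given fuel. -/
def Dat.isTriv (D : Dat) (n : Nat) (w : Wd) : Bool := forceW w fun ww2 => D.triv n [] [ww2]

/-- Nontriviality test with the standard depth. -/
def Dat.isNon (D : Dat) (w : Wd) : Bool := D.nontriv 7 w

/-- Certificates. -/
def Dat.certC (D : Dat) (w : Wd) : Bool :=
  D.isNon w && allSt fun q => D.isTriv 130 (wcomm (wconj q w) w)

/-- Torsion certificate. -/
def Dat.certT (D : Dat) (w : Wd) (k : Nat) : Bool := D.isNon w && D.isTriv 130 (wpow w k)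

/-- Section certificate. -/
def Dat.certV (D : Dat) (w : Wd) (x : Bool) : Bool :=
  !(cnt D.al w) && (D.isTriv 130 (D.sec w x) && D.isNon w)

/-- Norm of a character. -/
def Dat.nrm (D : Dat) (χ : St → Bool) : St → Bool := fun q => xor (χ (D.t false q)) (χ (D.t true q))

/-- Turn values into a function. -/
def fn3 (x y z : α) : St → α
  | .a => x
  | .b => y
  | .c => z

/-- Evaluate a Boolean. -/
def forceB (x : Bool) (k : Bool → α) : α :=
  match x with
  | true => k true
  | false => k false

@[simp] theorem forceB_eq (x : Bool) (k : Bool → α) : forceB x k = k x := by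
  cases x <;> rfl

/-- Evaluate a character. -/
def forceC (χ : St → Bool) (k : (St → Bool) → α) : α :=
  forceB (χ .a) fun x => forceB (χ .b) fun y => forceB (χ .c) fun z => k (fn3 x y z)

@[simp] theorem forceC_eq (χ : St → Bool) (k : (St → Bool) → α) : forceC χ k = k χ := by
  simp only [forceC, forceB_eq]
  congr 1
  funext q
  cases q <;> rfl

/-- Determinant over the two-element field. -/
def det3 (u v w : St → Bool) : Bool :=
  xor (u .a && xor (v .b && w .c) (v .c && w .b))
    (xor (u .b && xor (v .a && w .c) (v .c && w .a))
      (u .c && xor (v .a && w .b) (v .b && w .a)))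

/-- The norms of the activity span all characters. -/
def Dat.rank3 (D : Dat) : Bool :=
  forceC D.al fun u => forceC (D.nrm u) fun v => forceC (D.nrm v) fun w => det3 u v w

/-- Bounded universal quantification over Booleans. -/
def allB (f : Bool → Bool) : Bool := f false && f true

theorem allB_iff (f : Bool → Bool) : allB f = true ↔ ∀ q, f q = true := by
  constructor
  · intro h q
    simp only [allB, Bool.and_eq_true] at h
    cases q
    · exact h.1
    · exact h.2
  · intro h
    simp [allB, h]

/-- Cyclic labelling of the words of length two. -/
def lab4 (o y z : Bool) : Nat :=
  match xor o y, xor o z with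
  | false, false => 0
  | true, true => 1
  | false, true => 2
  | true, false => 3

/-- Label difference. -/
def labD (o y z yy2 zz2 : Bool) : Nat := (lab4 o y z + 4 - lab4 o yy2 zz2) % 4

/-- Invariant set of pairs of words of length three. -/
def potP (o x y z xx2 yy2 zz2 : Bool) : Bool :=
  xor x xx2 && match xor o x with
    | false => Nat.beq (labD o y z yy2 zz2) 0 || Nat.beq (labD o y z yy2 zz2) 2
    | true => Nat.beq (labD o y z yy2 zz2) 1 || Nat.beq (labD o y z yy2 zz2) 3

/-- Potential on the invariant set. -/
def potF (o x y z _ yy2 zz2 : Bool) : Bool :=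
  match xor o x with
    | false => Nat.beq (labD o y z yy2 zz2) 2
    | true => Nat.beq (labD o y z yy2 zz2) 1

/-- The potential changes exactly under the state `t`. -/
def Dat.potCheck (D : Dat) (o : Bool) (t : St) : Bool :=
  allB fun i => allSt fun q => allB fun x => allB fun y => allB fun z =>
  allB fun xx2 => allB fun yy2 => allB fun zz2 =>
    !(potP o x y z xx2 yy2 zz2) ||
    (potP o (D.lout (.mk q i) x) (D.lout (D.lsec (.mk q i) x) y)
        (D.lout (D.lsec (D.lsec (.mk q i) x) y) z)
        (D.lout (.mk q i) xx2) (D.lout (D.lsec (.mk q i) xx2) yy2)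
        (D.lout (D.lsec (D.lsec (.mk q i) xx2) yy2) zz2) &&
      potF o (D.lout (.mk q i) x) (D.lout (D.lsec (.mk q i) x) y)
        (D.lout (D.lsec (D.lsec (.mk q i) x) y) z)
        (D.lout (.mk q i) xx2) (D.lout (D.lsec (.mk q i) xx2) yy2)
        (D.lout (D.lsec (D.lsec (.mk q i) xx2) yy2) zz2) ==
      xor (St.eqb t q) (potF o x y z xx2 yy2 zz2))

/-- The pattern of the Aleshin automaton. -/
def Dat.aleshin (D : Dat) (t p : St) (o : Bool) : Bool :=
  (allB fun x => allSt fun q => St.eqb t (D.t x q) == St.eqb p q)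
    && det3 D.al (St.eqb t) (St.eqb p) && D.potCheck o t

/-- Abbreviations for letters. -/
abbrev la : Lt := .mk .a false
/-- Abbreviations for letters. -/
abbrev lb : Lt := .mk .b false
/-- Abbreviations for letters. -/
abbrev lc : Lt := .mk .c false
/-- Abbreviations for letters. -/
abbrev lA : Lt := .mk .a true
/-- Abbreviations for letters. -/
abbrev lB : Lt := .mk .b true
/-- Abbreviations for letters. -/
abbrev lC : Lt := .mk .c true

/-- Certificates that the group is not free nonabelian. -/
def Dat.bads (D : Dat) : List Bool :=
  [ D.certT [la] 4, D.certT [la, lC] 4,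
    D.certC [la], D.certT [la, lB] 2,
    D.certC [lA, lc], D.certC [la, lB],
    D.certC [lb, lC], D.certV [lb, lc, lB, lC] false,
    D.certV [lb, lc, lB, lC] true, D.certV [la, lB, la, lB] false,
    D.certV [la, lB, la, lB] true, D.certV [la, lB, la, lC] false,
    D.certV [la, lB, la, lC] true, D.certV [la, lC, lb, lC] false,
    D.certV [la, lC, lb, lC] true, D.certV [la, lb, lA, lC] false,
    D.certV [la, lb, lA, lC] true, D.certV [la, lc, lA, lC] false,
    D.certV [la, lc, lA, lC] true, D.certV [la, lb, lC, lC] false,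
    D.certV [la, lb, lC, lC] true, D.certV [la, lc, lA, lB] false,
    D.certV [la, lc, lA, lB] true, D.certV [la, lC, lC, lb] false,
    D.certV [la, lC, lC, lb] true, D.certV [la, la, la, lB] false,
    D.certV [la, la, la, lB] true, D.certV [la, lB, lB, lB] false,
    D.certV [la, lB, lB, lB] true, D.certV [la, lb, la, lB] false,
    D.certV [la, lb, la, lB] true, D.certV [la, lb, lA, lb] false,
    D.certV [la, lb, lA, lb] true ]

/-- Certificates that the first homology modulo two has rank three. -/
def Dat.goods (D : Dat) : List Bool :=
  [ D.rank3, D.aleshin .b .c false, D.aleshin .b .c true, D.aleshin .a .c false,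
    D.aleshin .a .c true ]

/-- Data with sorted activity. -/
def mkDat (m : Bool) (p1 p2 p3 p4 p5 p6 : St) : Dat where
  al := fn3 true m false
  t := fun x => match x with
    | false => fn3 p1 p2 p3
    | true => fn3 p4 p5 p6

/-- Which certificate applies to which automaton (digits in base 38). -/
def table : Nat :=
  2852768570790067921293721312632096235378960477340878178459600175594156005440016154465970726583810387544431877460734595414679749806446110903998946867925701391665278889654495019607068120829675326196025665341908371808462462361875794801203173157573653257559786910334621535682910279864665375874047611054716183899035220164669426814186827130457538806440487561089889034445337728609070294917195361415000982385030425296411966197370544641071152365341400727356656599747355667668807262822518283814131910738543472221064622849668884661703654323007985462648574618278573698168471393956842616563212438208081107679775439679066460737573222655692437368821656012793654758484456133325303873068383529686854309829123501087572514400999013037467055274132700176084517014546591681815195824179813931267113933169757616046270095612617512935979104178837756426364585065980257098980428548876622639482007825114775663701118262221145386593349445497848550068449753779920750785565660426791408947610562908002353044752396780767601151919306106354553342588476657035342337404574719219392193087170145648884836098050876710150783979532886803285471430227998860214287040741794588329172010563910228047471075574097467928972083622792893172624454181676868135086585201442217360595504585179332519289403587936674664620312846053418646010323224812366313150630585200275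8171912785137960096362983225099113626305229522383742020169124382428103328578978139843237680813723910043003812459730164118238622571374898762879176580416042435621928449526178744831649977495462705650137433770606379097122141105535808002059895129540410104004130993820048104557433458982675621149924744377124368057975619968350974057685783411457975067281364876015421140653925237987447009111237817661177462851194870742185552405776263811855529939495141318909330212611412199451712414701308140961252675936565083409088053737754691184066358589869209431403506403097648151428843104084988004922163033832909065519025417798201951287274847073728264628826930520578077298544927678420615966671884813719458069957690826364722417218697875312175271031739290123520950234859292147752007150459854489100977795891091683344459524490878304934584221335970255017635835453119526225792239107776825117158052190391380517863478991431427473305813356702036496512370283487309987945021689281880707223894063616888957926085537392903911905829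

/-- Numbering of states. -/
def St.num : St → Nat
  | .a => 0
  | .b => 1
  | .c => 2

/-- Lookup of the certificate. -/
def code (m : Bool) (p1 p2 p3 p4 p5 p6 : St) : Nat :=
  table / 38 ^ (p6.num + 3 * (p5.num + 3 * (p4.num + 3 * (p3.num + 3 * (p2.num + 3 *
    (p1.num + 3 * (cond m 1 0))))))) % 38

/-- The selected certificate holds. -/
def Dat.check (D : Dat) (n : Nat) : Bool := (D.goods ++ D.bads).getD n false

set_option maxHeartbeats 4000000 in
theorem check_all_bool : (allB fun m => allSt fun p1 => allSt fun p2 => allSt fun p3 =>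
    allSt fun p4 => allSt fun p5 => allSt fun p6 =>
    (mkDat m p1 p2 p3 p4 p5 p6).check (code m p1 p2 p3 p4 p5 p6)) = true := by
  decide +kernel

theorem check_all : ∀ m p1 p2 p3 p4 p5 p6,
    (mkDat m p1 p2 p3 p4 p5 p6).check (code m p1 p2 p3 p4 p5 p6) = true := by
  have h := check_all_bool
  intro m p1 p2 p3 p4 p5 p6
  simp only [allB_iff, allSt_iff] at h
  exact h m p1 p2 p3 p4 p5 p6

/-- A realisation of the data by permutations of words. -/
structure Real3 (D : Dat) (g : St → Equiv.Perm (List Bool)) : Prop where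
  nil : ∀ q, g q [] = []
  cons : ∀ q x u, g q (x :: u) = xor (D.al q) x :: g (D.t x q) u

/-- Evaluation of a letter in a group. -/
def lev {Γ : Type*} [Group Γ] (g : St → Γ) : Lt → Γ
  | .mk q false => g q
  | .mk q true => (g q)⁻¹

/-- Evaluation of a word in a group; the head acts first. -/
def ev {Γ : Type*} [Group Γ] (g : St → Γ) : Wd → Γ
  | [] => 1
  | l :: w => ev g w * lev g l

section evlemmas
variable {Γ : Type*} [Group Γ] (g : St → Γ)

theorem lev_inv (l : Lt) : lev g l.inv = (lev g l)⁻¹ := by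
  rcases l with ⟨q, _ | _⟩ <;> simp [lev, Lt.inv]

theorem ev_rcons (l : Lt) (w : Wd) : ev g (rcons l w) = ev g w * lev g l := by
  cases w with
  | nil => simp [rcons, ev]
  | cons m v =>
    unfold rcons
    dsimp only
    split
    · rename_i h
      rw [Lt.eqb_iff] at h
      subst h
      simp [ev, lev_inv]
    · simp [ev]

theorem ev_wmul (v w : Wd) : ev g (wmul v w) = ev g w * ev g v := by
  induction v with
  | nil => simp [wmul, ev]
  | cons l v ih => simp [wmul, ev, ev_rcons, ih, mul_assoc]

theorem ev_append (v w : Wd) : ev g (v ++ w) = ev g w * ev g v := by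
  induction v with
  | nil => simp [ev]
  | cons l v ih => simp [ev, ih, mul_assoc]

theorem ev_winv (w : Wd) : ev g (winv w) = (ev g w)⁻¹ := by
  induction w with
  | nil => simp [winv, ev]
  | cons l v ih => simp [winv, ev, ev_wmul, ih, lev_inv]

theorem ev_wpow (w : Wd) (n : ℕ) : ev g (wpow w n) = (ev g w) ^ n := by
  induction n with
  | zero => simp [wpow, ev]
  | succ n ih => simp [wpow, ev_wmul, ih, pow_succ]

theorem ev_map {Δ : Type*} [Group Δ] (f : Γ →* Δ) (w : Wd) :
    f (ev g w) = ev (fun q => f (g q)) w := by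
  induction w with
  | nil => simp [ev]
  | cons l v ih => rcases l with ⟨q, _ | _⟩ <;> simp [ev, ih, lev]

theorem ev_surj (hg : Subgroup.closure (Set.range g) = ⊤) (x : Γ) : ∃ w, ev g w = x := by
  have hx : x ∈ Subgroup.closure (Set.range g) := by rw [hg]; trivial
  induction hx using Subgroup.closure_induction with
  | mem x hx =>
    obtain ⟨q, rfl⟩ := hx
    exact ⟨[.mk q false], by simp [ev, lev]⟩
  | one => exact ⟨[], rfl⟩
  | mul x y _ _ hx hy =>
    obtain ⟨v, rfl⟩ := hx
    obtain ⟨w, rfl⟩ := hy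
    exact ⟨wmul w v, ev_wmul g _ _⟩
  | inv x _ hx =>
    obtain ⟨v, rfl⟩ := hx
    exact ⟨winv v, ev_winv g _⟩

end evlemmas

theorem cnt_rcons (χ : St → Bool) (l : Lt) (w : Wd) :
    cnt χ (rcons l w) = cnt χ (l :: w) := by
  cases w with
  | nil => simp [rcons]
  | cons m v =>
    unfold rcons
    dsimp only
    split
    · rename_i h
      rw [Lt.eqb_iff] at h
      subst h
      rcases m with ⟨q, i⟩
      simp [cnt, Lt.inv]
    · rfl

theorem cnt_append (χ : St → Bool) (v w : Wd) :
    cnt χ (v ++ w) = xor (cnt χ v) (cnt χ w) := by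
  induction v with
  | nil => simp [cnt]
  | cons l v ih => rcases l with ⟨q, i⟩; simp [cnt, ih]

theorem cnt_wmul (χ : St → Bool) (v w : Wd) :
    cnt χ (wmul v w) = xor (cnt χ v) (cnt χ w) := by
  induction v with
  | nil => simp [wmul, cnt]
  | cons l v ih =>
    rcases l with ⟨q, i⟩
    simp [wmul, cnt_rcons, cnt, ih]

theorem cnt_winv (χ : St → Bool) (v : Wd) : cnt χ (winv v) = cnt χ v := by
  induction v with
  | nil => simp [winv, cnt]
  | cons l v ih =>
    rcases l with ⟨q, i⟩
    simp [winv, cnt_wmul, Lt.inv, cnt, ih, Bool.xor_comm]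

theorem sec_cons (D : Dat) (l : Lt) (w : Wd) (x : Bool) :
    D.sec (l :: w) x = rcons (D.lsec l x) (D.sec w (D.lout l x)) := by
  rw [Dat.sec]
  split <;> rename_i h <;> rw [h]

section realisation
variable {D : Dat} {g : St → Equiv.Perm (List Bool)}

theorem lev_nil (R : Real3 D g) (l : Lt) : lev g l [] = [] := by
  rcases l with ⟨q, _ | _⟩
  · exact R.nil q
  · simp only [lev]
    rw [Equiv.Perm.inv_eq_iff_eq, R.nil]

theorem lev_cons (R : Real3 D g) (l : Lt) (x : Bool) (u : List Bool) :
    lev g l (x :: u) = D.lout l x :: lev g (D.lsec l x) u := by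
  rcases l with ⟨q, _ | _⟩
  · exact R.cons q x u
  · simp only [lev, Dat.lout, Dat.lsec]
    rw [Equiv.Perm.inv_eq_iff_eq, R.cons]
    simp

theorem ev_nil (R : Real3 D g) (w : Wd) : ev g w [] = [] := by
  induction w with
  | nil => simp [ev]
  | cons l v ih => simp [ev, lev_nil R, ih]

theorem ev_cons (R : Real3 D g) (w : Wd) (x : Bool) (u : List Bool) :
    ev g w (x :: u) = xor (cnt D.al w) x :: ev g (D.sec w x) u := by
  induction w generalizing x u with
  | nil => simp [ev, cnt, Dat.sec]
  | cons l v ih =>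
    rw [sec_cons, ev_rcons]
    simp only [ev, Equiv.Perm.mul_apply, lev_cons R, ih]
    rcases l with ⟨q, i⟩
    simp only [cnt, Dat.lout]
    congr 1
    cases D.al q <;> cases cnt D.al v <;> cases x <;> rfl

theorem triv_closed (R : Real3 D g) (S : List Wd)
    (hS : ∀ w ∈ S, cnt D.al w = false ∧ ∀ x, D.sec w x ∈ S) (w : Wd) (hw : w ∈ S) :
    ev g w = 1 := by
  ext1 u
  induction u generalizing w with
  | nil => simp [ev_nil R]
  | cons x u ih =>
    rw [ev_cons R, (hS w hw).1, ih _ ((hS w hw).2 x)]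
    simp

theorem triv_aux (n : ℕ) (S td : List Wd) (h : D.triv n S td = true)
    (hS : ∀ w ∈ S, cnt D.al w = false ∧ ∀ x, D.sec w x ∈ S ∨ D.sec w x ∈ td) :
    ∃ SS2 : List Wd, (∀ w ∈ SS2, cnt D.al w = false ∧ ∀ x, D.sec w x ∈ SS2) ∧
      (∀ w ∈ S, w ∈ SS2) ∧ ∀ w ∈ td, w ∈ SS2 := by
  induction n generalizing S td with
  | zero =>
    cases td with
    | nil => exact ⟨S, fun w hw => by simpa using hS w hw, by simp, by simp⟩
    | cons v td => simp [Dat.triv] at h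
  | succ n ih =>
    cases td with
    | nil => exact ⟨S, fun w hw => by simpa using hS w hw, by simp, by simp⟩
    | cons v td =>
      rw [Dat.triv] at h
      split at h
      · rename_i hm
        rw [wmem_iff] at hm
        obtain ⟨SS2, h1, h2, h3⟩ := ih S td h (fun w hw => ⟨(hS w hw).1, fun x => by
          rcases (hS w hw).2 x with h | h
          · exact Or.inl h
          · rcases List.mem_cons.1 h with h | h
            · exact Or.inl (h ▸ hm)
            · exact Or.inr h⟩)
        refine ⟨SS2, h1, h2, fun w hw => ?_⟩
        rcases List.mem_cons.1 hw with h | h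
        · exact h2 _ (h ▸ hm)
        · exact h3 _ h
      · split at h
        · simp at h
        · rename_i _ hc
          simp only [forceW_eq] at h
          obtain ⟨SS2, h1, h2, h3⟩ := ih _ _ h (fun w hw => by
            rcases List.mem_cons.1 hw with h | h
            · subst h
              exact ⟨hc, fun x => by cases x <;> simp⟩
            · refine ⟨(hS w h).1, fun x => ?_⟩
              rcases (hS w h).2 x with h | h
              · simp [h]
              · rcases List.mem_cons.1 h with h | h <;> simp [h])
          refine ⟨SS2, h1, fun w hw => h2 w (by simp [hw]), fun w hw => ?_⟩
          rcases List.mem_cons.1 hw with h | h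
          · exact h2 _ (by simp [h])
          · exact h3 _ (by simp [h])

theorem isTriv_sound (R : Real3 D g) (n : ℕ) (w : Wd) (h : D.isTriv n w = true) : ev g w = 1 := by
  simp only [Dat.isTriv, forceW_eq] at h
  obtain ⟨SS2, h1, _, h3⟩ := triv_aux n _ _ h (by simp)
  exact triv_closed R SS2 h1 w (h3 w (by simp))

theorem ev_one_sec (R : Real3 D g) (w : Wd) (h : ev g w = 1) : cnt D.al w = false ∧ ∀ x, ev g (D.sec w x) = 1 := by
  constructor
  · have := ev_cons R w false []
    rw [h] at this
    simp only [Equiv.Perm.coe_one, id, List.cons.injEq] at this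
    simpa using this.1.symm
  · intro x
    ext1 u
    have := ev_cons R w x u
    rw [h] at this
    simp only [Equiv.Perm.coe_one, id, List.cons.injEq] at this
    simpa using this.2.symm

theorem nontriv_sound (R : Real3 D g) (n : ℕ) (w : Wd) (h : D.nontriv n w = true) : ev g w ≠ 1 := by
  intro he
  induction n generalizing w with
  | zero => simp [Dat.nontriv] at h
  | succ n ih =>
    obtain ⟨h1, h2⟩ := ev_one_sec R w he
    simp only [Dat.nontriv, h1, forceW_eq] at h
    split at h
    · exact ih _ (by assumption) (h2 false)
    · exact ih _ h (h2 true)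

end realisation

section freegroups

theorem gens_subsingleton {α : Type*} (h : ∀ x y : FreeGroup α, x * y = y * x) :
    Subsingleton α := by
  classical
  refine ⟨fun i j => ?_⟩
  by_contra hij
  let f : FreeGroup α →* Equiv.Perm (Fin 3) :=
    FreeGroup.lift fun k => if k = i then Equiv.swap 0 1 else Equiv.swap 1 2
  have h1 := congrArg f (h (FreeGroup.of i) (FreeGroup.of j))
  simp only [map_mul, f, FreeGroup.lift_apply_of, if_true, if_neg (Ne.symm hij)] at h1
  revert h1
  decide

theorem cyclic_of_free_comm {Γ : Type*} [Group Γ] [IsFreeGroup Γ]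
    (h : ∀ x y : Γ, x * y = y * x) : ∃ z : Γ, ∀ x : Γ, ∃ n : ℤ, x = z ^ n := by
  let e := IsFreeGroup.toFreeGroup Γ
  have hs : Subsingleton (IsFreeGroup.Generators Γ) := gens_subsingleton fun x y => by
    have := congrArg e (h (e.symm x) (e.symm y))
    simpa using this
  rcases isEmpty_or_nonempty (IsFreeGroup.Generators Γ) with he | ⟨⟨i⟩⟩
  · refine ⟨1, fun x => ⟨0, ?_⟩⟩
    apply e.injective
    exact Subsingleton.elim _ _
  · refine ⟨e.symm (FreeGroup.of i), fun x => ?_⟩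
    have key : ∀ y : FreeGroup (IsFreeGroup.Generators Γ), ∃ n : ℤ, y = FreeGroup.of i ^ n := by
      intro y
      induction y using FreeGroup.induction_on with
      | C1 => exact ⟨0, by simp⟩
      | of k => exact ⟨1, by rw [Subsingleton.elim k i]; simp⟩
      | inv_of k _ => exact ⟨-1, by rw [Subsingleton.elim k i]; simp⟩
      | mul x y hx hy =>
        obtain ⟨m, rfl⟩ := hx
        obtain ⟨n, rfl⟩ := hy
        exact ⟨m + n, by rw [zpow_add]⟩
    obtain ⟨n, hn⟩ := key (e x)
    refine ⟨n, ?_⟩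
    apply e.injective
    rw [hn]
    simp

theorem comm_pair {F : Type*} [Group F] [IsFreeGroup F] (z y : F) (h : z * y = y * z) :
    ∃ c : F, (∃ m : ℤ, z = c ^ m) ∧ ∃ n : ℤ, y = c ^ n := by
  let H := Subgroup.closure ({z, y} : Set F)
  have hc : ∀ a b : H, a * b = b * a := by
    have : ∀ a ∈ ({z, y} : Set F), ∀ b ∈ ({z, y} : Set F), a * b = b * a := by
      rintro a (rfl | rfl) b (rfl | rfl) <;> simp [h]
    have inst := Subgroup.isMulCommutative_closure (k := ({z, y} : Set F)) this
    exact fun a b => inst.is_comm.comm a b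
  obtain ⟨c, hc⟩ := cyclic_of_free_comm (Γ := H) hc
  obtain ⟨m, hm⟩ := hc ⟨z, Subgroup.subset_closure (by simp)⟩
  obtain ⟨n, hn⟩ := hc ⟨y, Subgroup.subset_closure (by simp)⟩
  exact ⟨c, ⟨m, by simpa using congrArg Subtype.val hm⟩, ⟨n, by simpa using congrArg Subtype.val hn⟩⟩

theorem central_pow {α : Type*} (z : FreeGroup α) (i : α)
    (h : z * FreeGroup.of i = FreeGroup.of i * z) : ∃ m : ℤ, z = FreeGroup.of i ^ m := by
  obtain ⟨c, ⟨m, hm⟩, ⟨n, hn⟩⟩ := comm_pair z (FreeGroup.of i) h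
  let f : FreeGroup α →* Multiplicative ℤ := FreeGroup.lift fun _ => Multiplicative.ofAdd 1
  have h1 := congrArg (fun x => Multiplicative.toAdd (f x)) hn
  simp only [f, FreeGroup.lift_apply_of, toAdd_ofAdd, map_zpow, toAdd_zpow, smul_eq_mul] at h1
  rcases Int.isUnit_iff.1 (IsUnit.of_mul_eq_one _ h1.symm) with h2 | h2
  · subst h2
    exact ⟨m, by rw [hn, hm]; simp⟩
  · subst h2
    exact ⟨-m, by rw [hn, hm]; simp⟩

theorem center_free {α : Type*} (z : FreeGroup α) (hz : z ≠ 1)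
    (h : ∀ x, z * x = x * z) : ∀ x y : FreeGroup α, x * y = y * x := by
  classical
  have hs : Subsingleton α := by
    refine ⟨fun i j => ?_⟩
    by_contra hij
    obtain ⟨m, hm⟩ := central_pow z i (h _)
    obtain ⟨n, hn⟩ := central_pow z j (h _)
    let f : FreeGroup α →* Multiplicative ℤ :=
      FreeGroup.lift fun k => if k = i then Multiplicative.ofAdd 1 else 1
    have h1 := congrArg (fun x => Multiplicative.toAdd (f x)) (hm.symm.trans hn)
    simp only [f, FreeGroup.lift_apply_of, map_zpow, toAdd_zpow, smul_eq_mul,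
      if_true, if_neg (Ne.symm hij), toAdd_ofAdd, mul_one, toAdd_one, mul_zero] at h1
    apply hz
    rw [hm, h1, zpow_zero]
  intro x y
  rcases isEmpty_or_nonempty α with he | ⟨⟨i⟩⟩
  · exact Subsingleton.elim _ _
  · have hc : ∀ x : FreeGroup α, x * FreeGroup.of i = FreeGroup.of i * x := by
      intro x
      induction x using FreeGroup.induction_on with
      | C1 => simp
      | of k => rw [Subsingleton.elim k i]
      | inv_of k _ => rw [Subsingleton.elim k i]; simp
      | mul x y hx hy => rw [mul_assoc, hy, ← mul_assoc, hx, mul_assoc]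
    obtain ⟨m, hm⟩ := central_pow x i (hc _)
    obtain ⟨n, hn⟩ := central_pow y i (hc _)
    rw [hm, hn, ← zpow_add, ← zpow_add, add_comm]

theorem center_free_group {Γ : Type*} [Group Γ] [IsFreeGroup Γ] (z : Γ) (hz : z ≠ 1)
    (h : ∀ x, z * x = x * z) : ∀ x y : Γ, x * y = y * x := by
  let e := IsFreeGroup.toFreeGroup Γ
  have h1 := center_free (e z) (by simpa using hz) (fun x => by
    have := congrArg e (h (e.symm x))
    simpa using this)
  intro x y
  apply e.injective
  rw [map_mul, map_mul, h1]

variable {Γ : Type*} [Group Γ] [IsFreeGroup Γ]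

theorem comm_trans {x y z : Γ} (hz : z ≠ 1) (hx : z * x = x * z) (hy : z * y = y * z) :
    x * y = y * x := by
  let C := Subgroup.centralizer ({z} : Set Γ)
  have hC : ∀ u : Γ, z * u = u * z → u ∈ C := by
    intro u hu
    rw [Subgroup.mem_centralizer_iff]
    rintro _ rfl
    exact hu
  have h := center_free_group (Γ := C) ⟨z, hC z rfl⟩ (fun h => hz (congrArg Subtype.val h))
    (fun u => by
      have := u.2
      rw [Subgroup.mem_centralizer_iff] at this
      exact Subtype.ext (this z rfl))
    ⟨x, hC x hx⟩ ⟨y, hC y hy⟩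
  exact congrArg Subtype.val h

theorem free_torsion {x : Γ} {n : ℕ} (hn : n ≠ 0) (h : x ^ n = 1) : x = 1 := by
  let e := IsFreeGroup.toFreeGroup Γ
  apply e.injective
  apply pow_left_injective hn
  simp only [map_one, one_pow, ← map_pow, h]

theorem lemmaN {x : Γ} (hx : x ≠ 1) {S : Set Γ} (hS : Subgroup.closure S = ⊤)
    (h : ∀ q ∈ S, (q * x * q⁻¹) * x = x * (q * x * q⁻¹)) : ∀ u v : Γ, u * v = v * u := by
  -- conjugates of `x` are nontrivial
  have hne : ∀ g : Γ, g * x * g⁻¹ ≠ 1 := by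
    intro g hg
    apply hx
    simpa [mul_assoc] using congrArg (fun t => g⁻¹ * t * g) hg
  have all : ∀ g : Γ, x * (g * x * g⁻¹) = (g * x * g⁻¹) * x := by
    intro g
    have hg : g ∈ Subgroup.closure S := by rw [hS]; trivial
    induction hg using Subgroup.closure_induction with
    | mem q hq => exact (h q hq).symm
    | one => simp
    | mul a b _ _ ha hb =>
      have h1 : (a * x * a⁻¹) * (a * b * x * (a * b)⁻¹) = (a * b * x * (a * b)⁻¹) * (a * x * a⁻¹) := by
        have := congrArg (fun t => a * t * a⁻¹) hb
        simpa [mul_assoc] using this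
      exact comm_trans (hne a) ha.symm h1
    | inv a _ ha =>
      have := congrArg (fun t => a⁻¹ * t * a) ha
      simpa [mul_assoc] using this.symm
  let C := Subgroup.centralizer ({x} : Set Γ)
  have hC : ∀ u : Γ, u ∈ C ↔ x * u = u * x := by
    intro u
    rw [Subgroup.mem_centralizer_iff]
    simp
  have hconj : ∀ g u : Γ, u ∈ C → g * u * g⁻¹ ∈ C := by
    intro g u hu
    rw [hC] at hu ⊢
    refine comm_trans (hne g) (all g).symm ?_
    have := congrArg (fun t => g * t * g⁻¹) hu
    simpa [mul_assoc] using this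
  obtain ⟨z, hz⟩ := cyclic_of_free_comm (Γ := C) (fun u v => Subtype.ext
    (comm_trans hx ((hC _).1 u.2) ((hC _).1 v.2)))
  have hzpow : ∀ u ∈ C, ∃ n : ℤ, u = (z : Γ) ^ n := by
    intro u hu
    obtain ⟨n, hn⟩ := hz ⟨u, hu⟩
    exact ⟨n, by simpa using congrArg Subtype.val hn⟩
  have hz1 : (z : Γ) ≠ 1 := by
    intro h0
    obtain ⟨n, hn⟩ := hzpow x ((hC x).2 rfl)
    rw [h0, one_zpow] at hn
    exact hx hn
  have fin : ∀ g : Γ, z * g = g * z := by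
    intro g
    obtain ⟨n, hn⟩ := hzpow _ (hconj g z z.2)
    obtain ⟨m, hm⟩ := hzpow _ (hconj g⁻¹ z z.2)
    have h1 : (z : Γ) ^ (m * n - 1) = 1 := by
      rw [zpow_sub, zpow_mul, ← hm, zpow_one]
      have : (g⁻¹ * (z : Γ) * g⁻¹⁻¹) ^ n = g⁻¹ * (z : Γ) ^ n * g⁻¹⁻¹ := conj_zpow
      rw [this, ← hn]
      simp [mul_assoc]
    have h2 : m * n = 1 := by
      by_contra h2
      have h3 : m * n - 1 ≠ 0 := sub_ne_zero.2 h2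
      apply hz1
      apply free_torsion (Int.natAbs_ne_zero.2 h3)
      rcases Int.natAbs_eq (m * n - 1) with h4 | h4
      · rw [h4, zpow_natCast] at h1
        exact h1
      · rw [h4, zpow_neg, inv_eq_one, zpow_natCast] at h1
        exact h1
    rcases Int.isUnit_iff.1 (IsUnit.of_mul_eq_one_right _ h2) with h3 | h3
    · rw [h3, zpow_one] at hn
      exact (mul_inv_eq_iff_eq_mul.1 hn).symm
    · rw [h3, zpow_neg, zpow_one] at hn
      by_cases hg : g = 1
      · simp [hg]
      have hg2 : g ^ 2 ≠ 1 := fun h => hg (free_torsion two_ne_zero h)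
      have h4 : g * z = (z : Γ)⁻¹ * g := mul_inv_eq_iff_eq_mul.1 hn
      have h5 : g * (z : Γ)⁻¹ = z * g := by
        have := congrArg (fun t => (z : Γ) * t * (z : Γ)⁻¹) h4
        simpa [mul_assoc] using this.symm
      refine comm_trans hg2 ?_ ?_
      · rw [pow_two, mul_assoc, h4, ← mul_assoc, h5, mul_assoc]
      · rw [pow_two, mul_assoc]
  intro u v
  exact comm_trans hz1 (fin u) (fin v)

end freegroups

section certificates
variable {D : Dat} {g : St → Equiv.Perm (List Bool)}

theorem ev_mem (w : Wd) : ev g w ∈ Subgroup.closure (Set.range g) := by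
  have hl : ∀ l : Lt, lev g l ∈ Subgroup.closure (Set.range g) := by
    rintro ⟨q, _ | _⟩
    · exact Subgroup.subset_closure ⟨q, rfl⟩
    · exact Subgroup.inv_mem _ (Subgroup.subset_closure ⟨q, rfl⟩)
  induction w with
  | nil => exact Subgroup.one_mem _
  | cons l v ih => exact Subgroup.mul_mem _ ih (hl l)

theorem gen_mem (q : St) : g q ∈ Subgroup.closure (Set.range g) :=
  Subgroup.subset_closure ⟨q, rfl⟩

theorem comm_trans_perm {G : Subgroup (Equiv.Perm (List Bool))} [IsFreeGroup G]
    {x y z : Equiv.Perm (List Bool)} (hxG : x ∈ G) (hyG : y ∈ G) (hzG : z ∈ G)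
    (hz : z ≠ 1) (hx : z * x = x * z) (hy : z * y = y * z) : x * y = y * x := by
  have := comm_trans (Γ := G) (x := ⟨x, hxG⟩) (y := ⟨y, hyG⟩) (z := ⟨z, hzG⟩)
    (fun h => hz (congrArg Subtype.val h)) (Subtype.ext hx) (Subtype.ext hy)
  exact congrArg Subtype.val this

theorem not_lemmaN [IsFreeGroup (Subgroup.closure (Set.range g))]
    (hna : ¬ ∀ u v : Subgroup.closure (Set.range g), u * v = v * u) (w : Wd) (hw : ev g w ≠ 1)
    (h : ∀ q, (g q * ev g w * (g q)⁻¹) * ev g w = ev g w * (g q * ev g w * (g q)⁻¹)) : False := by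
  apply hna
  refine lemmaN (x := ⟨ev g w, ev_mem w⟩) (fun h => hw (congrArg Subtype.val h))
    (Subgroup.closure_closure_coe_preimage (k := Set.range g)) ?_
  rintro ⟨_, hq⟩ ⟨q, rfl⟩
  exact Subtype.ext (h q)

theorem commute_of_fix {p r : Equiv.Perm (List Bool)} {x : Bool}
    (hpn : p [] = []) (hrn : r [] = [])
    (hp : ∀ u, p (x :: u) = x :: u) (hr : ∀ u, r ((!x) :: u) = (!x) :: u)
    (hpsh : ∀ u, ∃ v, p ((!x) :: u) = (!x) :: v) (hrsh : ∀ u, ∃ v, r (x :: u) = x :: v) :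
    p * r = r * p := by
  ext1 u
  simp only [Equiv.Perm.mul_apply]
  cases u with
  | nil => rw [hpn, hrn, hpn]
  | cons y u =>
    by_cases hy : y = x
    · subst hy
      obtain ⟨v, hv⟩ := hrsh u
      rw [hp, hv, hp]
    · obtain rfl : y = !x := by cases x <;> cases y <;> simp_all
      obtain ⟨v, hv⟩ := hpsh u
      rw [hr, hv, hr]

theorem conj_shape (R : Real3 D g) (q : St) (w : Wd) (hw : cnt D.al w = false) (y : Bool)
    (u : List Bool) : ∃ v, (g q * ev g w * (g q)⁻¹) (y :: u) = y :: v := by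
  have h : g q * ev g w * (g q)⁻¹ = ev g (.mk q true :: (w ++ [.mk q false])) := by
    simp [ev, ev_append, lev]
  rw [h, ev_cons R]
  simp [cnt, cnt_append, hw]

theorem conj_fix (R : Real3 D g) (q : St) (w : Wd) (x : Bool)
    (hf : ∀ u, ev g w (x :: u) = x :: u) (u : List Bool) :
    (g q * ev g w * (g q)⁻¹) (xor (D.al q) x :: u) = xor (D.al q) x :: u := by
  have h : (g q)⁻¹ (xor (D.al q) x :: u) = x :: (g (D.t x q))⁻¹ u := by
    rw [Equiv.Perm.inv_eq_iff_eq, R.cons]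
    simp
  simp only [Equiv.Perm.mul_apply]
  rw [h, hf, R.cons]
  simp

theorem conj_nil (R : Real3 D g) (q : St) (w : Wd) : (g q * ev g w * (g q)⁻¹) [] = [] := by
  have h : g q * ev g w * (g q)⁻¹ = ev g (.mk q true :: (w ++ [.mk q false])) := by
    simp [ev, ev_append, lev]
  rw [h, ev_nil R]

theorem lemmaV (R : Real3 D g) [IsFreeGroup (Subgroup.closure (Set.range g))]
    (hna : ¬ ∀ u v : Subgroup.closure (Set.range g), u * v = v * u)
    (s : St) (hs : D.al s = true) (w : Wd) (hw : ev g w ≠ 1) (hc : cnt D.al w = false)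
    (x : Bool) (hx : ev g (D.sec w x) = 1) : False := by
  have hf : ∀ u, ev g w (x :: u) = x :: u := by
    intro u
    rw [ev_cons R, hc, hx]
    simp
  have hsh : ∀ y u, ∃ v, ev g w (y :: u) = y :: v := by
    intro y u
    rw [ev_cons R, hc]
    simp
  -- for active states the conjugate commutes
  have hact : ∀ q, D.al q = true →
      ev g w * (g q * ev g w * (g q)⁻¹) = (g q * ev g w * (g q)⁻¹) * ev g w := by
    intro q hq
    refine commute_of_fix (x := x) (ev_nil R w) (conj_nil R q w) hf ?_ (hsh _) ?_
    · intro u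
      have := conj_fix R q w x hf u
      simpa [hq] using this
    · exact conj_shape R q w hc x
  refine not_lemmaN hna w hw fun q => ?_
  cases hq : D.al q with
  | true => exact (hact q hq).symm
  | false =>
    have hmem : ∀ q, g q * ev g w * (g q)⁻¹ ∈ Subgroup.closure (Set.range g) := fun q =>
      Subgroup.mul_mem _ (Subgroup.mul_mem _ (gen_mem q) (ev_mem w))
        (Subgroup.inv_mem _ (gen_mem q))
    refine comm_trans_perm (hmem q) (ev_mem w) (hmem s) ?_ ?_ ?_
    · intro h
      apply hw
      simpa [mul_assoc] using congrArg (fun t => (g s)⁻¹ * t * g s) h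
    · symm
      refine commute_of_fix (x := x) (conj_nil R q w) (conj_nil R s w) ?_ ?_
        (conj_shape R q w hc _) (conj_shape R s w hc _)
      · intro u
        simpa [hq] using conj_fix R q w x hf u
      · intro u
        simpa [hs] using conj_fix R s w x hf u
    · exact (hact s hs).symm

theorem certC_sound (R : Real3 D g) [IsFreeGroup (Subgroup.closure (Set.range g))]
    (hna : ¬ ∀ u v : Subgroup.closure (Set.range g), u * v = v * u) (w : Wd)
    (h : D.certC w = true) : False := by
  simp only [Dat.certC, Bool.and_eq_true, allSt_iff] at h
  refine not_lemmaN hna w (nontriv_sound R _ _ h.1) fun q => ?_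
  have h1 := isTriv_sound R _ _ (h.2 q)
  simp only [wcomm, wconj, ev_wmul, ev_winv, ev, lev, one_mul] at h1
  have h2 : (ev g w) * ((g q)⁻¹ * ev g w * g q) = ((g q)⁻¹ * ev g w * g q) * ev g w := by
    have key : ∀ u c : Equiv.Perm (List Bool), u⁻¹ * c⁻¹ * u * c = 1 → u * c = c * u := by
      intro u c h
      calc u * c = c * u * (u⁻¹ * c⁻¹ * u * c) := by group
        _ = c * u := by rw [h, mul_one]
    exact key _ _ h1
  have h3 := congrArg (fun t => g q * t * (g q)⁻¹) h2
  simpa [mul_assoc] using h3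

theorem certT_sound (R : Real3 D g) [IsFreeGroup (Subgroup.closure (Set.range g))] (w : Wd)
    (k : ℕ) (hk : k ≠ 0) (h : D.certT w k = true) : False := by
  simp only [Dat.certT, Bool.and_eq_true] at h
  have h1 := isTriv_sound R _ _ h.2
  rw [ev_wpow] at h1
  have h2 := free_torsion (Γ := Subgroup.closure (Set.range g)) (x := ⟨ev g w, ev_mem w⟩) hk
    (Subtype.ext h1)
  exact nontriv_sound R _ _ h.1 (congrArg Subtype.val h2)

theorem certV_sound (R : Real3 D g) [IsFreeGroup (Subgroup.closure (Set.range g))]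
    (hna : ¬ ∀ u v : Subgroup.closure (Set.range g), u * v = v * u)
    (s : St) (hs : D.al s = true) (w : Wd) (x : Bool) (h : D.certV w x = true) : False := by
  simp only [Dat.certV, Bool.and_eq_true, Bool.not_eq_true'] at h
  obtain ⟨h1, h2, h3⟩ := h
  exact lemmaV R hna s hs w (nontriv_sound R _ _ h3) h1 _ (isTriv_sound R _ _ h2)

theorem bad_sound (R : Real3 D g) [IsFreeGroup (Subgroup.closure (Set.range g))]
    (hna : ¬ ∀ u v : Subgroup.closure (Set.range g), u * v = v * u)
    (s : St) (hs : D.al s = true) (h : true ∈ D.bads) : False := by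
  have hC : ∀ w, true = D.certC w → False := fun w h => certC_sound R hna w h.symm
  have hV : ∀ w x, true = D.certV w x → False := fun w x h => certV_sound R hna s hs w x h.symm
  have hT : ∀ w k, k ≠ 0 → true = D.certT w k → False := fun w k hk h =>
    certT_sound R w k hk h.symm
  unfold Dat.bads at h
  repeat' first
    | exact absurd h List.not_mem_nil
    | exact hC _ h
    | exact hV _ _ h
    | exact hT _ _ (by norm_num) h
    | rcases List.mem_cons.1 h with h | h

end certificates

section characters
variable {D : Dat} {g : St → Equiv.Perm (List Bool)}

/-- A character vanishing on relations. -/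
def Good (g : St → Equiv.Perm (List Bool)) (χ : St → Bool) : Prop :=
  ∀ w, ev g w = 1 → cnt χ w = false

theorem cnt_xor (χ ψ : St → Bool) (w : Wd) :
    cnt (fun q => xor (χ q) (ψ q)) w = xor (cnt χ w) (cnt ψ w) := by
  induction w with
  | nil => rfl
  | cons l w ih =>
    rcases l with ⟨q, i⟩
    simp only [cnt, ih]
    cases χ q <;> cases ψ q <;> cases cnt χ w <;> cases cnt ψ w <;> rfl

theorem good_zero : Good g fun _ => false := by
  intro w hw
  clear hw
  induction w with
  | nil => rfl
  | cons l w ih => rcases l with ⟨q, i⟩; simpa [cnt] using ih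

theorem good_xor {χ ψ : St → Bool} (h1 : Good g χ) (h2 : Good g ψ) :
    Good g fun q => xor (χ q) (ψ q) := by
  intro w hw
  rw [cnt_xor, h1 w hw, h2 w hw]
  rfl

theorem good_al (R : Real3 D g) : Good g D.al := fun w hw => (ev_one_sec R w hw).1

theorem cnt_sec_nrm (D : Dat) (χ : St → Bool) (w : Wd) :
    xor (cnt χ (D.sec w false)) (cnt χ (D.sec w true)) = cnt (D.nrm χ) w := by
  induction w with
  | nil => rfl
  | cons l w ih =>
    rw [sec_cons, sec_cons, cnt_rcons, cnt_rcons]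
    rcases l with ⟨q, _ | _⟩ <;> simp only [cnt, Dat.lsec, Dat.lout, ← ih, Dat.nrm] <;>
    cases D.al q <;> simp only [Bool.xor_false, Bool.xor_true,
      Bool.not_false, Bool.not_true] <;>
    generalize cnt χ (D.sec w false) = p <;> generalize cnt χ (D.sec w true) = r <;>
    generalize χ (D.t false q) = pp2 <;> generalize χ (D.t true q) = rr2 <;>
    revert p r pp2 rr2 <;> decide

theorem good_nrm (R : Real3 D g) {χ : St → Bool} (h : Good g χ) : Good g (D.nrm χ) := by
  intro w hw
  obtain ⟨_, h2⟩ := ev_one_sec R w hw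
  rw [← cnt_sec_nrm, h _ (h2 _), h _ (h2 _)]
  rfl

theorem good_r1 (R : Real3 D g) {χ ψ : St → Bool} (h : Good g χ)
    (hψ : ∀ x q, χ (D.t x q) = ψ q) : Good g ψ := by
  have key : ∀ w x, cnt χ (D.sec w x) = cnt ψ w := by
    intro w
    induction w with
    | nil => intro x; rfl
    | cons l w ih =>
      intro x
      rw [sec_cons, cnt_rcons]
      rcases l with ⟨q, _ | _⟩ <;> simp [cnt, Dat.lsec, ih, hψ]
  intro w hw
  rw [← key w false]
  exact h _ ((ev_one_sec R w hw).2 false)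

theorem span_of_det (u v w χ : St → Bool) (h : det3 u v w = true) :
    ∃ x y z : Bool, χ = fun q => xor (x && u q) (xor (y && v q) (z && w q)) := by
  have key : ∀ ua ub uc va vb vc wa wb wc a b c : Bool,
      det3 (fn3 ua ub uc) (fn3 va vb vc) (fn3 wa wb wc) = true →
      ∃ x y z : Bool, a = xor (x && ua) (xor (y && va) (z && wa)) ∧
        b = xor (x && ub) (xor (y && vb) (z && wb)) ∧
        c = xor (x && uc) (xor (y && vc) (z && wc)) := by
    decide +kernel
  obtain ⟨x, y, z, h1, h2, h3⟩ := key (u .a) (u .b) (u .c) (v .a) (v .b) (v .c) (w .a) (w .b)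
    (w .c) (χ .a) (χ .b) (χ .c) h
  refine ⟨x, y, z, ?_⟩
  funext q
  cases q
  · exact h1
  · exact h2
  · exact h3

theorem good_smul {χ : St → Bool} (h : Good g χ) (x : Bool) : Good g fun q => x && χ q := by
  cases x
  · simpa using good_zero
  · simpa using h

theorem all_good_of_det {u v w : St → Bool} (hu : Good g u) (hv : Good g v) (hw : Good g w)
    (h : det3 u v w = true) (χ : St → Bool) : Good g χ := by
  obtain ⟨x, y, z, rfl⟩ := span_of_det u v w χ h
  exact good_xor (good_smul hu x) (good_xor (good_smul hv y) (good_smul hw z))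

theorem all_good_of_rank3 (R : Real3 D g) (h : D.rank3 = true) (χ : St → Bool) : Good g χ := by
  simp only [Dat.rank3, forceC_eq] at h
  exact all_good_of_det (good_al R) (good_nrm R (good_al R)) (good_nrm R (good_nrm R (good_al R)))
    h χ

theorem lev_three (R : Real3 D g) (l : Lt) (x y z : Bool) :
    lev g l [x, y, z] = [D.lout l x, D.lout (D.lsec l x) y,
      D.lout (D.lsec (D.lsec l x) y) z] := by
  rw [lev_cons R, lev_cons R, lev_cons R, lev_nil R]

/-- The potential shows that the indicator of `t` is good. -/
theorem good_of_pot (R : Real3 D g) (o : Bool) (t : St) (h : D.potCheck o t = true) :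
    Good g (St.eqb t) := by
  simp only [Dat.potCheck, allB_iff, allSt_iff] at h
  have hw : ∀ w x y z xx2 yy2 zz2, potP o x y z xx2 yy2 zz2 = true →
      ∃ X Y Z XX2 YY2 ZZ2, ev g w [x, y, z] = [X, Y, Z] ∧ ev g w [xx2, yy2, zz2] = [XX2, YY2, ZZ2] ∧
        potP o X Y Z XX2 YY2 ZZ2 = true ∧
        potF o X Y Z XX2 YY2 ZZ2 = xor (cnt (St.eqb t) w) (potF o x y z xx2 yy2 zz2) := by
    intro w
    induction w with
    | nil =>
      intro x y z xx2 yy2 zz2 hp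
      exact ⟨x, y, z, xx2, yy2, zz2, rfl, rfl, hp, by simp [cnt]⟩
    | cons l w ih =>
      intro x y z xx2 yy2 zz2 hp
      rcases l with ⟨q, i⟩
      have h1 := h i q x y z xx2 yy2 zz2
      rw [hp] at h1
      simp only [Bool.not_true, Bool.false_or, Bool.and_eq_true, beq_iff_eq] at h1
      obtain ⟨X, Y, Z, XX2, YY2, ZZ2, e1, e2, e3, e4⟩ := ih _ _ _ _ _ _ h1.1
      refine ⟨X, Y, Z, XX2, YY2, ZZ2, ?_, ?_, e3, ?_⟩
      · simp only [ev, Equiv.Perm.mul_apply, lev_three R, e1]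
      · simp only [ev, Equiv.Perm.mul_apply, lev_three R, e2]
      · rw [e4, h1.2]
        simp only [cnt]
        cases St.eqb t q <;> cases cnt (St.eqb t) w <;> cases potF o x y z xx2 yy2 zz2 <;> rfl
  intro w h1
  have hs : potP o o false false (!o) false false = true := by cases o <;> rfl
  obtain ⟨X, Y, Z, XX2, YY2, ZZ2, e1, e2, e3, e4⟩ := hw w _ _ _ _ _ _ hs
  rw [h1] at e1 e2
  simp only [Equiv.Perm.coe_one, id, List.cons.injEq, and_true] at e1 e2
  obtain ⟨rfl, rfl, rfl⟩ := e1
  obtain ⟨rfl, rfl, rfl⟩ := e2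
  revert e4
  cases cnt (St.eqb t) w <;> simp

theorem all_good_of_aleshin (R : Real3 D g) (t p : St) (o : Bool)
    (h : D.aleshin t p o = true) (χ : St → Bool) : Good g χ := by
  simp only [Dat.aleshin, Bool.and_eq_true, allSt_iff, allB_iff, beq_iff_eq] at h
  obtain ⟨⟨h2, h3⟩, h1⟩ := h
  have ht := good_of_pot R o t h1
  have hp : Good g (St.eqb p) := good_r1 R ht h2
  exact all_good_of_det (good_al R) ht hp h3 χ

end characters

section rank
variable {D : Dat} {g : St → Equiv.Perm (List Bool)}

/-- Booleans as elements of a group of order two. -/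
def toZ (x : Bool) : Multiplicative (ZMod 2) := Multiplicative.ofAdd (if x then 1 else 0)

theorem toZ_xor (x y : Bool) : toZ (xor x y) = toZ x * toZ y := by
  revert x y
  decide

theorem exists_hom (χ : St → Bool) (hχ : Good g χ) :
    ∃ f : Subgroup.closure (Set.range g) →* Multiplicative (ZMod 2),
      ∀ q, f ⟨g q, gen_mem q⟩ = toZ (χ q) := by
  have hs : ∀ x : Subgroup.closure (Set.range g), ∃ w, ev g w = x := by
    intro x
    obtain ⟨w, hw⟩ := ev_surj (Γ := Subgroup.closure (Set.range g)) (fun q => ⟨g q, gen_mem q⟩)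
      (by
        rw [← Subgroup.closure_closure_coe_preimage (k := Set.range g)]
        congr 1
        ext ⟨y, hy⟩
        simp) x
    refine ⟨w, ?_⟩
    rw [← hw]
    exact (ev_map (fun q => (⟨g q, gen_mem q⟩ : Subgroup.closure (Set.range g)))
      (Subgroup.closure (Set.range g)).subtype w).symm
  choose W hW using hs
  have key : ∀ v w, ev g v = ev g w → cnt χ v = cnt χ w := by
    intro v w h
    have h1 := hχ (wmul v (winv w)) (by rw [ev_wmul, ev_winv, h]; simp)
    rw [cnt_wmul, cnt_winv] at h1
    simpa using h1
  refine ⟨MonoidHom.mk' (fun x => toZ (cnt χ (W x))) ?_, ?_⟩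
  · intro x y
    rw [← toZ_xor, ← cnt_wmul, key (W (x * y)) (wmul (W y) (W x))]
    · rw [cnt_wmul, cnt_wmul, Bool.xor_comm]
    · rw [ev_wmul, hW, hW, hW]
      rfl
  · intro q
    have := key (W ⟨g q, gen_mem q⟩) [.mk q false] (by rw [hW]; simp [ev, lev])
    simp only [MonoidHom.mk'_apply, this]
    simp [cnt]

theorem rank_three (hall : ∀ χ, Good g χ) (ι : Type)
    (e : Subgroup.closure (Set.range g) ≃* FreeGroup ι) :
    Nonempty (Subgroup.closure (Set.range g) ≃* FreeGroup (Fin 3)) := by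
  classical
  let M := Multiplicative (ZMod 2)
  let Φ : (ι → M) → (St → M) := fun h q => FreeGroup.lift h (e ⟨g q, gen_mem q⟩)
  have inj : Function.Injective Φ := by
    intro h hh2 hh
    have h1 : ((FreeGroup.lift h).comp e.toMonoidHom) = ((FreeGroup.lift hh2).comp e.toMonoidHom) := by
      apply MonoidHom.eq_of_eqOn_dense (Subgroup.closure_closure_coe_preimage (k := Set.range g))
      rintro ⟨_, hq⟩ ⟨q, rfl⟩
      exact congrFun hh q
    have h2 : FreeGroup.lift h = FreeGroup.lift hh2 := by
      ext x
      have := DFunLike.congr_fun h1 (e.symm (FreeGroup.of x))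
      simpa using this
    exact FreeGroup.lift.injective h2
  have surj : Function.Surjective Φ := by
    intro φ
    have h2 : ∀ m : M, ∃ x, toZ x = m := by
      change ∀ m : Multiplicative (ZMod 2), ∃ x, toZ x = m
      decide
    choose b hb using h2
    obtain ⟨f, hf⟩ := exists_hom (g := g) (fun q => b (φ q)) (hall _)
    refine ⟨fun i => f (e.symm (FreeGroup.of i)), ?_⟩
    have h1 : FreeGroup.lift (fun i => f (e.symm (FreeGroup.of i))) = f.comp e.symm.toMonoidHom := by
      ext x
      simp
    funext q
    simp only [Φ, h1]
    simp [hf, hb]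
  have hbij : Nat.card (ι → M) = Nat.card (St → M) := Nat.card_congr (Equiv.ofBijective Φ ⟨inj, surj⟩)
  have hfin : Finite (ι → M) := Finite.of_injective Φ inj
  have hM : Nontrivial M := inferInstanceAs (Nontrivial (Multiplicative (ZMod 2)))
  have hι : Finite ι := by
    obtain ⟨m, hm⟩ := exists_ne (1 : M)
    refine Finite.of_injective (fun i : ι => (Pi.mulSingle i m : ι → M)) ?_
    intro i j hij
    by_contra hne
    have := congrFun hij i
    simp only [Pi.mulSingle_eq_same, Pi.mulSingle_eq_of_ne hne] at this
    exact hm this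
  have := Fintype.ofFinite ι
  have hcM : Nat.card M = 2 := by simp [M]
  rw [Nat.card_fun, Nat.card_fun, hcM] at hbij
  have h3 : Nat.card St = 3 := by
    rw [Nat.card_eq_fintype_card]
    rfl
  have hc : Nat.card ι = 3 := by
    rw [h3] at hbij
    exact Nat.pow_right_injective le_rfl hbij
  have e2 : ι ≃ Fin 3 := Finite.equivFinOfCardEq hc
  exact ⟨e.trans (FreeGroup.freeGroupCongr e2)⟩

end rank

theorem constant_eq {D : Dat} {g : St → Equiv.Perm (List Bool)} (R : Real3 D g)
    (h : ∀ p q, D.al p = D.al q) (p q : St) : g p = g q := by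
  ext1 u
  induction u generalizing p q with
  | nil => rw [R.nil, R.nil]
  | cons x u ih => rw [R.cons, R.cons, h p q, ih]

theorem constant_comm {D : Dat} {g : St → Equiv.Perm (List Bool)} (R : Real3 D g)
    (h : ∀ p q, D.al p = D.al q) :
    ∀ u v : Subgroup.closure (Set.range g), u * v = v * u := by
  have inst := Subgroup.isMulCommutative_closure (k := Set.range g) (by
    rintro _ ⟨p, rfl⟩ _ ⟨q, rfl⟩
    rw [constant_eq R h p q])
  exact fun a b => inst.is_comm.comm a b

theorem sort_activity (f : St → Bool) (h : ¬ ∀ p q, f p = f q) :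
    ∃ (σ : Equiv.Perm St) (m : Bool), ∀ q, f (σ q) = fn3 true m false q := by
  have key : ∀ x y z : Bool, (¬ ∀ p q, fn3 x y z p = fn3 x y z q) →
      ∃ (σ : Equiv.Perm St) (m : Bool), ∀ q, fn3 x y z (σ q) = fn3 true m false q := by
    decide
  have hf : fn3 (f .a) (f .b) (f .c) = f := by
    funext q
    cases q <;> rfl
  have := key (f .a) (f .b) (f .c)
  rw [hf] at this
  exact this h

theorem main_sorted {D : Dat} {g : St → Equiv.Perm (List Bool)} (R : Real3 D g) (m : Bool)
    (hal : D.al = fn3 true m false) (ι : Type)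
    (e : Subgroup.closure (Set.range g) ≃* FreeGroup ι)
    (hna : ¬ ∀ u v : Subgroup.closure (Set.range g), u * v = v * u) :
    Nonempty (Subgroup.closure (Set.range g) ≃* FreeGroup (Fin 3)) := by
  have : IsFreeGroup (Subgroup.closure (Set.range g)) := IsFreeGroup.ofMulEquiv e.symm
  have hD : D = mkDat m (D.t false .a) (D.t false .b) (D.t false .c)
      (D.t true .a) (D.t true .b) (D.t true .c) := by
    rcases D with ⟨al, t⟩
    simp only [mkDat, Dat.mk.injEq]
    refine ⟨hal, ?_⟩
    funext x q
    cases x <;> cases q <;> rfl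
  have hc := check_all m (D.t false .a) (D.t false .b) (D.t false .c)
      (D.t true .a) (D.t true .b) (D.t true .c)
  rw [← hD] at hc
  have hm : true ∈ D.goods ++ D.bads := by
    rw [Dat.check] at hc
    generalize code m (D.t false .a) (D.t false .b) (D.t false .c)
      (D.t true .a) (D.t true .b) (D.t true .c) = n at hc
    by_cases hn : n < (D.goods ++ D.bads).length
    · rw [List.getD_eq_getElem _ _ hn] at hc
      rw [← hc]
      exact List.getElem_mem hn
    · rw [List.getD_eq_default _ _ (not_lt.1 hn)] at hc
      exact absurd hc (by simp)
  rcases List.mem_append.1 hm with h | h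
  · simp only [Dat.goods, List.mem_cons, List.not_mem_nil, or_false] at h
    rcases h with h | h | h | h | h
    · exact rank_three (all_good_of_rank3 R h.symm) ι e
    · exact rank_three (all_good_of_aleshin R _ _ _ h.symm) ι e
    · exact rank_three (all_good_of_aleshin R _ _ _ h.symm) ι e
    · exact rank_three (all_good_of_aleshin R _ _ _ h.symm) ι e
    · exact rank_three (all_good_of_aleshin R _ _ _ h.symm) ι e
  · exact (bad_sound R hna .a (by rw [hal]; rfl) h).elim

end Aut3

open Aut3

/-- If the group generated by an invertible automaton with 3 states over a
2-letter alphabet is a non-abelian free group, then it is free of rank 3. -/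
theorem free_three_state_automaton_group_has_rank_three
    (Q : Type) [Fintype Q] (hQ : Fintype.card Q = 3) (A : BinAutomaton Q)
    (ι : Type) (hfree : Nonempty (↥A.autGroup ≃* FreeGroup ι))
    (hnonab : ∃ g ∈ A.autGroup, ∃ h ∈ A.autGroup, g * h ≠ h * g) :
    Nonempty (↥A.autGroup ≃* FreeGroup (Fin 3)) := by
  obtain ⟨e⟩ := hfree
  have real : ∀ s : St ≃ Q, Real3
      ⟨fun q => A.out (s q) false, fun x q => s.symm (A.trans (s q) x)⟩ (fun q => A.perm (s q)) := by
    intro s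
    refine ⟨fun q => rfl, fun q x u => ?_⟩
    have h1 : A.perm (s q) (x :: u) = A.out (s q) x :: A.perm (A.trans (s q) x) u := rfl
    rw [h1]
    simp only [Equiv.apply_symm_apply, List.cons.injEq, and_true]
    have h2 := (A.out_bij (s q)).1.ne (a₁ := false) (a₂ := true) (by simp)
    cases x <;> simp only [Bool.xor_false, Bool.xor_true]
    revert h2
    cases A.out (s q) false <;> cases A.out (s q) true <;> simp
  have hG : ∀ s : St ≃ Q, A.autGroup = Subgroup.closure (Set.range fun q => A.perm (s q)) := by
    intro s
    have : (Set.range fun q => A.perm (s q)) = Set.range A.perm := s.surjective.range_comp A.perm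
    rw [this]
    rfl
  have hna : ∀ s : St ≃ Q,
      ¬ ∀ u v : Subgroup.closure (Set.range fun q => A.perm (s q)), u * v = v * u := by
    intro s hs
    obtain ⟨x, hx, y, hy, hxy⟩ := hnonab
    rw [hG s] at hx hy
    exact hxy (congrArg Subtype.val (hs ⟨x, hx⟩ ⟨y, hy⟩))
  have s0 : St ≃ Q := Fintype.equivOfCardEq (by rw [hQ]; rfl)
  by_cases hconst : ∀ p q : St, A.out (s0 p) false = A.out (s0 q) false
  · exact (hna s0 (constant_comm (real s0) hconst)).elim
  · obtain ⟨σ, m, hσ⟩ := sort_activity (fun q => A.out (s0 q) false) hconst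
    let s := σ.trans s0
    have e1 : A.autGroup ≃* Subgroup.closure (Set.range fun q => A.perm (s q)) :=
      MulEquiv.subgroupCongr (hG s)
    obtain ⟨f⟩ := main_sorted (real s) m (funext hσ) ι (e1.symm.trans e) (hna s)
    exact ⟨e1.trans f⟩
end

section
/- Let a, b, c be the tree automorphisms of the binary tree defined by the wreath recursions a = σ(b,c), b = σ(c,b), c = (a,a) (the Aleshin–Vorobets automaton, number 2240). Then the group generated by a, b, c is a free group of rank 3 with free basis {a, b, c}. -/
/-- The Aleshin–Vorobets automaton, number 2240:
`a = σ(b,c)`, `b = σ(c,b)`, `c = (a,a)` (states `0 = a`, `1 = b`, `2 = c`). -/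
def A2240 : BinAutomaton (Fin 3) :=
  mkAut3 ![1, 2, 0] ![2, 1, 0] ![true, true, false]

noncomputable def a : Equiv.Perm (List Bool) := A2240.perm 0
noncomputable def b : Equiv.Perm (List Bool) := A2240.perm 1
noncomputable def c : Equiv.Perm (List Bool) := A2240.perm 2

namespace AV

/-- The four involutions: the Bellaterra states and the global flip `D`. -/
inductive L where
  | A | B | C | D
  deriving DecidableEq

open L

instance : Fintype L := ⟨{A, B, C, D}, by intro x; cases x <;> simp⟩

/-- Activity of a letter at the root. -/
def tog : L → Bool
  | A => false
  | B => false
  | C => true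
  | D => true

/-- Whether a letter is one of `A, B, C`. -/
def isS : L → Bool
  | D => false
  | _ => true

/-- Swap `A` and `B`. -/
def sw : L → L
  | A => B
  | B => A
  | C => C
  | D => D

/-- Swap `B` and `C`. -/
def ro : L → L
  | A => A
  | B => C
  | C => B
  | D => D

/-- Apply `sw` at places preceded by an odd number of active letters. -/
def h : Bool → List L → List L
  | _, [] => []
  | e, x :: w => (cond e (sw x) x) :: h (xor e (tog x)) w

def par : List L → Bool
  | [] => false
  | x :: w => xor (tog x) (par w)

abbrev Red (w : List L) : Prop := List.IsChain (fun x y => x ≠ y) w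

abbrev pat (w : List L) : List Bool := w.map isS

theorem sw_sw (x : L) : sw (sw x) = x := by cases x <;> rfl
theorem ro_ro (x : L) : ro (ro x) = x := by cases x <;> rfl

theorem map_sw_sw (w : List L) : (w.map sw).map sw = w := by
  simp [Function.comp_def, sw_sw]
theorem map_ro_ro (w : List L) : (w.map ro).map ro = w := by
  simp [Function.comp_def, ro_ro]

theorem h_not (w : List L) (e : Bool) : h (!e) w = (h e w).map sw := by
  induction w generalizing e with
  | nil => rfl
  | cons x w ih =>
    simp only [h, List.map_cons]
    rw [show xor (!e) (tog x) = !(xor e (tog x)) by simp, ih]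
    cases e <;> simp [sw_sw]

theorem h_true (w : List L) : h true w = (h false w).map sw := h_not w false

theorem h_append (u v : List L) (e : Bool) : h e (u ++ v) = h e u ++ h (xor e (par u)) v := by
  induction u generalizing e with
  | nil => simp [h, par]
  | cons x u ih => simp [h, par, ih]

theorem h_h (w : List L) (e : Bool) : h e (h e w) = w := by
  induction w generalizing e with
  | nil => rfl
  | cons x w ih =>
    have h1 : tog (cond e (sw x) x) = tog x := by cases e <;> cases x <;> rfl
    have h2 : cond e (sw (cond e (sw x) x)) (cond e (sw x) x) = x := by
      cases e <;> cases x <;> rfl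
    simp only [h, h1, h2, ih]

theorem pat_sw (w : List L) : pat (w.map sw) = pat w := by
  simp only [pat, List.map_map]
  congr 1; funext x; cases x <;> rfl
theorem pat_ro (w : List L) : pat (w.map ro) = pat w := by
  simp only [pat, List.map_map]
  congr 1; funext x; cases x <;> rfl
theorem pat_h (w : List L) (e : Bool) : pat (h e w) = pat w := by
  induction w generalizing e with
  | nil => rfl
  | cons x w ih =>
    have := ih (xor e (tog x))
    simp only [pat] at this
    simp only [h, pat, List.map_cons, this]
    cases e <;> cases x <;> rfl

theorem red_map (f : L → L) (hf : ∀ x, f (f x) = x) (w : List L) (hw : Red w) :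
    Red (w.map f) := by
  rw [Red, List.isChain_map]
  refine hw.imp ?_
  intro x y hxy he
  apply hxy
  rw [← hf x, he, hf]

theorem red_h (w : List L) (e : Bool) (hw : Red w) : Red (h e w) := by
  induction w generalizing e with
  | nil => exact hw
  | cons x w ih =>
    cases w with
    | nil => simp [h]
    | cons y w =>
      have h1 := ih (xor e (tog x)) (List.IsChain.tail hw)
      simp only [h] at h1 ⊢
      refine List.isChain_cons_cons.2 ⟨?_, h1⟩
      have := (List.isChain_cons_cons.1 hw).1
      revert this
      cases e <;> cases x <;> cases y <;> simp [sw, tog]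

/-- Sets of words invariant under the dual group. -/
structure Inv (O : Set (List L)) : Prop where
  s : ∀ w ∈ O, w.map sw ∈ O
  r : ∀ w ∈ O, w.map ro ∈ O
  h : ∀ w ∈ O, h false w ∈ O

theorem Inv.compl {O : Set (List L)} (hO : Inv O) : Inv Oᶜ where
  s w hw h1 := hw (by simpa only [map_sw_sw] using hO.s _ h1)
  r w hw h1 := hw (by simpa only [map_ro_ro] using hO.r _ h1)
  h w hw h1 := hw (by simpa only [h_h] using hO.h _ h1)

theorem Inv.h_any {O : Set (List L)} (hO : Inv O) (e : Bool) (w : List L) (hw : w ∈ O) :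
    AV.h e w ∈ O := by
  cases e
  · exact hO.h w hw
  · rw [h_true]; exact hO.s _ (hO.h w hw)

theorem Inv.of_h_any {O : Set (List L)} (hs : ∀ w ∈ O, w.map sw ∈ O)
    (hr : ∀ w ∈ O, w.map ro ∈ O) (hh : ∀ w ∈ O, ∃ e, AV.h e w ∈ O) : Inv O where
  s := hs
  r := hr
  h w hw := by
    obtain ⟨e, he⟩ := hh w hw
    cases e
    · exact he
    · have := hs _ he
      rwa [h_true, map_sw_sw] at this

/-- Transitivity on reduced words with pattern `W`. -/
def P (W : List Bool) : Prop :=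
  ∀ w w', Red w → Red w' → pat w = W → pat w' = W → ∀ O, Inv O → w ∈ O → w' ∈ O

theorem P_of_canon (W : List Bool) (g : List L)
    (hg : ∀ w, Red w → pat w = W → ∀ O, Inv O → w ∈ O → g ∈ O) : P W := by
  intro w w' hw hw' hp hp' O hO hwO
  by_contra hn
  exact hg w' hw' hp' _ hO.compl hn (hg w hw hp O hO hwO)

theorem isS_false {x : L} (hx : isS x = false) : x = D := by cases x <;> simp_all [isS]

theorem pat_cons {w : List L} {i : Bool} {V : List Bool} (hw : pat w = i :: V) :
    ∃ x v, w = x :: v ∧ isS x = i ∧ pat v = V := by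
  simpa [pat, List.map_eq_cons_iff] using hw

theorem pat_concat {w : List L} {i : Bool} {V : List Bool} (hw : pat w = V ++ [i]) :
    ∃ v x, w = v ++ [x] ∧ isS x = i ∧ pat v = V := by
  obtain ⟨v, t, h1, h2, h3⟩ := List.map_eq_append_iff.1 hw
  obtain ⟨x, v', h4, h5, h6⟩ := pat_cons h3
  simp [pat] at h6
  subst h6
  exact ⟨v, x, by rw [h1, h4], h5, h2⟩

theorem P_nil : P [] := by
  intro w w' _ _ hp hp' O _ hwO
  simp [pat] at hp hp'
  subst hp hp'
  exact hwO

theorem P_d {V : List Bool} (hV : P V) : P (false :: V) := by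
  intro w w' hw hw' hp hp' O hO hwO
  obtain ⟨x, v, rfl, hx, hv⟩ := pat_cons hp
  obtain ⟨x', v', rfl, hx', hv'⟩ := pat_cons hp'
  obtain rfl := isS_false hx
  obtain rfl := isS_false hx'
  refine hV v v' hw.tail hw'.tail hv hv' {v | D :: v ∈ O} ?_ hwO
  refine Inv.of_h_any (fun w hw => hO.s _ hw) (fun w hw => hO.r _ hw) fun w hw => ?_
  exact ⟨true, hO.h _ hw⟩

theorem P_d' {V : List Bool} (hV : P V) : P (V ++ [false]) := by
  intro w w' hw hw' hp hp' O hO hwO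
  obtain ⟨v, x, rfl, hx, hv⟩ := pat_concat hp
  obtain ⟨v', x', rfl, hx', hv'⟩ := pat_concat hp'
  obtain rfl := isS_false hx
  obtain rfl := isS_false hx'
  refine hV v v' hw.left_of_append hw'.left_of_append hv hv' {v | v ++ [D] ∈ O} ?_ hwO
  refine ⟨fun w hw => ?_, fun w hw => ?_, fun w hw => ?_⟩
  · simpa [sw] using hO.s _ hw
  · simpa [ro] using hO.r _ hw
  · have := hO.h _ hw
    rw [h_append] at this
    have h2 : h (xor false (par w)) [D] = [D] := by cases par w <;> rfl
    rwa [h2] at this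

theorem P_one : P [true] := by
  apply P_of_canon _ [A]
  intro w _ hp O hO hwO
  obtain ⟨x, v, rfl, hx, hv⟩ := pat_cons hp
  simp [pat] at hv
  subst hv
  cases x
  · exact hwO
  · exact hO.s _ hwO
  · exact hO.s _ (hO.r _ hwO)
  · simp [isS] at hx

theorem P_sds : P [true, false, true] := by
  apply P_of_canon _ [A, D, A]
  intro w _ hp O hO hwO
  obtain ⟨x, v, rfl, hx, hv⟩ := pat_cons hp
  obtain ⟨y, v, rfl, hy, hv1⟩ := pat_cons hv
  obtain ⟨z, v, rfl, hz, hv2⟩ := pat_cons hv1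
  obtain rfl := isS_false hy
  simp only [pat, List.map_eq_nil_iff] at hv2
  subst hv2
  have key : ∀ z, isS z = true → [A, D, z] ∈ O → [A, D, A] ∈ O := by
    intro z hz hm
    cases z
    · exact hm
    · exact hO.h _ hm
    · exact hO.h _ (hO.r _ hm)
    · simp [isS] at hz
  have hsw : ∀ z, isS (sw z) = isS z := by intro z; cases z <;> rfl
  have hro : ∀ z, isS (ro z) = isS z := by intro z; cases z <;> rfl
  cases x
  · exact key _ hz hwO
  · exact key (sw z) (by rw [hsw, hz]) (hO.s _ hwO)
  · exact key (sw (ro z)) (by rw [hsw, hro, hz]) (hO.s _ (hO.r _ hwO))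
  · simp [isS] at hx

abbrev Ok (V : List Bool) : Prop := List.IsChain (fun x y => (x || y) = true) V

theorem good2 : ∀ (V : List Bool), Ok V → ∀ y, isS y = true →
    ∃ g, pat g = V ∧ h false g = g ∧ Red (y :: g)
  | [], _, y, _ => ⟨[], rfl, rfl, by simp⟩
  | [false], _, y, hy => ⟨[D], rfl, rfl, by cases y <;> simp_all [isS]⟩
  | false :: false :: V, hV, _, _ => by simp [Ok] at hV
  | true :: V, hV, y, hy => by
    have hy' : ∃ y', isS y' = true ∧ tog y' = false ∧ y ≠ y' := by
      revert y; decide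
    obtain ⟨y', h1, h2, h3⟩ := hy'
    obtain ⟨g, hg1, hg2, hg3⟩ := good2 V hV.tail y' h1
    refine ⟨y' :: g, ?_, ?_, ?_⟩
    · simp only [pat] at hg1 ⊢
      simp [h1, hg1]
    · simp [h, h2, hg2]
    · exact List.isChain_cons_cons.2 ⟨h3, hg3⟩
  | false :: true :: V, hV, y, hy => by
    obtain ⟨g, hg1, hg2, hg3⟩ := good2 V hV.tail.tail C rfl
    refine ⟨D :: C :: g, ?_, ?_, ?_⟩
    · simp only [pat] at hg1 ⊢
      simp [isS, hg1]
    · simp [h, tog, sw, hg2]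
    · refine List.isChain_cons_cons.2 ⟨?_, List.isChain_cons_cons.2 ⟨by simp, hg3⟩⟩
      rintro rfl; simp [isS] at hy

theorem good1 : ∀ (V : List Bool), Ok V → V.head? = some true → V.getLast? = some true →
    ∀ e : Bool, ∃ g, pat (g ++ [C]) = V ∧ h false g = g ∧ par g = false ∧ Red (g ++ [C]) ∧
      (g ++ [C]).head? ≠ some (cond e A B)
  | [], _, hh, _, _ => by simp at hh
  | false :: _, _, hh, _, _ => by simp at hh
  | [true], _, _, _, e => ⟨[], rfl, rfl, rfl, by simp, by cases e <;> simp⟩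
  | [true, false], _, _, hl, _ => by simp at hl
  | true :: false :: false :: V, hV, _, _, _ => by simp [Ok] at hV
  | true :: true :: V, hV, _, hl, e => by
    obtain ⟨g, h1, h2, h3, h4, h5⟩ := good1 (true :: V) hV.tail rfl (by simpa using hl) (!e)
    refine ⟨cond (!e) A B :: g, ?_, ?_, ?_, ?_, ?_⟩
    · simp only [pat] at h1
      simp only [pat, List.cons_append, List.map_cons, h1]
      cases e <;> rfl
    · cases e <;> simp [h, tog, h2]
    · cases e <;> simp [par, tog, h3]
    · rw [List.cons_append]
      refine List.isChain_cons.2 ⟨?_, h4⟩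
      intro y hy hy2
      apply h5
      rw [hy2]; exact hy
    · cases e <;> simp
  | true :: false :: true :: V, hV, _, hl, e => by
    obtain ⟨g, h1, h2, h3, h4, h5⟩ := good1 (true :: V) hV.tail.tail rfl (by simpa using hl) (!e)
    refine ⟨C :: D :: g, ?_, ?_, ?_, ?_, ?_⟩
    · simp only [pat] at h1
      simp only [pat, List.cons_append, List.map_cons, h1]
      rfl
    · simp [h, tog, sw, h2]
    · simp [par, tog, h3]
    · rw [List.cons_append, List.cons_append]
      refine List.isChain_cons_cons.2 ⟨by simp, List.isChain_cons.2 ⟨?_, h4⟩⟩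
      rintro y hy rfl
      have : (pat (g ++ [C])).head? = some true := by rw [h1]; rfl
      simp only [pat, List.head?_map] at this
      rw [hy] at this
      simp [isS] at this
    · cases e <;> simp

theorem P_left {V : List Bool} (hok : Ok V) (hV : P (true :: V)) : P (true :: true :: V) := by
  obtain ⟨g, hg1, hg2, hg3⟩ := good2 V hok C rfl
  have hfix : h true (C :: g) = C :: g := by simp [h, sw, tog, hg2]
  apply P_of_canon _ (A :: C :: g)
  intro w hw hp O hO hwO
  obtain ⟨x, v, rfl, hx, hv⟩ := pat_cons hp
  have hI : Inv {v | ∃ x, isS x = true ∧ Red (x :: v) ∧ x :: v ∈ O} := by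
    refine Inv.of_h_any ?_ ?_ ?_
    · rintro w ⟨x, hx, h1, h2⟩
      exact ⟨sw x, by cases x <;> simp_all [isS, sw], red_map sw sw_sw _ h1, hO.s _ h2⟩
    · rintro w ⟨x, hx, h1, h2⟩
      exact ⟨ro x, by cases x <;> simp_all [isS, ro], red_map ro ro_ro _ h1, hO.r _ h2⟩
    · rintro w ⟨x, hx, h1, h2⟩
      exact ⟨_, x, hx, red_h _ false h1, hO.h _ h2⟩
  obtain ⟨x, hx, h1, h2⟩ := hV v (C :: g) hw.tail hg3 hv
    (by simp only [pat] at hg1 ⊢; simp [isS, hg1]) _ hI ⟨x, hx, hw, hwO⟩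
  cases x
  · exact h2
  · have h3 := hO.s _ (hO.h _ h2)
    rw [← h_true] at h3
    have h4 : h true (B :: C :: g) = A :: h true (C :: g) := rfl
    rwa [h4, hfix] at h3
  · exact absurd rfl (List.isChain_cons_cons.1 h1).1
  · simp [isS] at hx

theorem xS_sw {x : L} (hx : isS x = true) : isS (sw x) = true := by cases x <;> simp_all [isS, sw]
theorem xS_ro {x : L} (hx : isS x = true) : isS (ro x) = true := by cases x <;> simp_all [isS, ro]

theorem Inv_right {O : Set (List L)} (hO : Inv O) :
    Inv {u | ∃ x, isS x = true ∧ Red (u ++ [x]) ∧ u ++ [x] ∈ O} := by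
  refine ⟨?_, ?_, ?_⟩
  · rintro w ⟨x, hx, h1, h2⟩
    refine ⟨sw x, xS_sw hx, ?_, ?_⟩
    · simpa using red_map sw sw_sw _ h1
    · simpa using hO.s _ h2
  · rintro w ⟨x, hx, h1, h2⟩
    refine ⟨ro x, xS_ro hx, ?_, ?_⟩
    · simpa using red_map ro ro_ro _ h1
    · simpa using hO.r _ h2
  · rintro w ⟨x, hx, h1, h2⟩
    have h3 := red_h _ false h1
    have h4 := hO.h _ h2
    rw [h_append] at h3 h4
    refine ⟨cond (xor false (par w)) (sw x) x, ?_, h3, h4⟩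
    cases (xor false (par w))
    · exact hx
    · exact xS_sw hx

theorem P_right {V : List Bool} (hok : Ok V) (hh : V.head? = some true)
    (hl : V.getLast? = some true) (hV : P V) : P (V ++ [true]) := by
  obtain ⟨g, h1, h2, h3, h4, -⟩ := good1 V hok hh hl true
  apply P_of_canon _ ((g ++ [C]) ++ [A])
  intro w hw hp O hO hwO
  obtain ⟨v, x, rfl, hx, hv⟩ := pat_concat hp
  obtain ⟨x, hx, h5, h6⟩ := hV v (g ++ [C]) hw.left_of_append h4 hv h1 _ (Inv_right hO)
    ⟨x, hx, hw, hwO⟩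
  have hfix : h false (g ++ [C]) = g ++ [C] := by rw [h_append, h2, h3]; rfl
  have hpar : ∀ w : List L, par (w ++ [C]) = !par w := by
    intro w
    induction w with
    | nil => rfl
    | cons x w ih => simp [par, ih]
  cases x
  · exact h6
  · have h7 := hO.h _ h6
    rw [h_append, hfix, hpar, h3] at h7
    exact h7
  · rw [List.append_assoc] at h5
    have := h5.right_of_append
    simp at this
  · simp [isS] at hx

theorem isS_D : isS D = false := rfl
theorem isS_B : isS B = true := rfl
theorem isS_C : isS C = true := rfl
theorem sw_B : sw B = A := rfl
theorem sw_D : sw D = D := rfl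

theorem fin_unique (p : L → Prop) : (∃! x, isS x = true ∧ p x) ↔
    ((p A ∧ ¬ p B ∧ ¬ p C) ∨ (¬ p A ∧ p B ∧ ¬ p C) ∨ (¬ p A ∧ ¬ p B ∧ p C)) := by
  constructor
  · rintro ⟨x, ⟨hx, hpx⟩, hun⟩
    have ha : p A → A = x := fun hh => hun A ⟨rfl, hh⟩
    have hb : p B → B = x := fun hh => hun B ⟨rfl, hh⟩
    have hc : p C → C = x := fun hh => hun C ⟨rfl, hh⟩
    clear hun
    cases x <;> simp_all [isS]
  · rintro (⟨h1, h2, h3⟩ | ⟨h1, h2, h3⟩ | ⟨h1, h2, h3⟩)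
    · exact ⟨A, ⟨rfl, h1⟩, by rintro y ⟨hy, hpy⟩; cases y <;> simp_all [isS]⟩
    · exact ⟨B, ⟨rfl, h2⟩, by rintro y ⟨hy, hpy⟩; cases y <;> simp_all [isS]⟩
    · exact ⟨C, ⟨rfl, h3⟩, by rintro y ⟨hy, hpy⟩; cases y <;> simp_all [isS]⟩

theorem Inv.s_iff {O : Set (List L)} (hO : Inv O) (w : List L) : w.map sw ∈ O ↔ w ∈ O :=
  ⟨fun hw => by simpa only [map_sw_sw] using hO.s _ hw, hO.s w⟩

theorem Inv.r_iff {O : Set (List L)} (hO : Inv O) (w : List L) : w.map ro ∈ O ↔ w ∈ O :=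
  ⟨fun hw => by simpa only [map_ro_ro] using hO.r _ hw, hO.r w⟩

theorem Inv.h_iff {O : Set (List L)} (hO : Inv O) (w : List L) : AV.h false w ∈ O ↔ w ∈ O :=
  ⟨fun hw => by simpa only [h_h] using hO.h _ hw, hO.h w⟩

theorem unique_transport {O : Set (List L)} (f : L → L) (hf : ∀ x, f (f x) = x)
    (hS : ∀ x, isS x = true → isS (f x) = true) (u u' : List L)
    (hu : ∀ x, u' ++ [f x] ∈ O ↔ u ++ [x] ∈ O)
    (h1 : ∃! x, isS x = true ∧ u ++ [x] ∈ O) : ∃! x, isS x = true ∧ u' ++ [x] ∈ O := by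
  obtain ⟨x, ⟨hx, hxO⟩, hun⟩ := h1
  refine ⟨f x, ⟨hS x hx, (hu x).2 hxO⟩, ?_⟩
  rintro y ⟨hy, hyO⟩
  have := hun (f y) ⟨hS y hy, (hu (f y)).1 (by rwa [hf])⟩
  rw [← this, hf]

theorem Inv_unique {O : Set (List L)} (hO : Inv O) :
    Inv {u | ∃! x, isS x = true ∧ u ++ [x] ∈ O} := by
  refine ⟨fun u hu => ?_, fun u hu => ?_, fun u hu => ?_⟩
  · refine unique_transport sw sw_sw (fun x => xS_sw) u _ (fun x => ?_) hu
    rw [← hO.s_iff (u ++ [x])]; simp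
  · refine unique_transport ro ro_ro (fun x => xS_ro) u _ (fun x => ?_) hu
    rw [← hO.r_iff (u ++ [x])]; simp
  · have key : ∀ x, h false u ++ [cond (par u) (sw x) x] ∈ O ↔ u ++ [x] ∈ O := by
      intro x
      rw [← hO.h_iff (u ++ [x]), h_append]; simp [h]
    refine unique_transport (fun x => cond (par u) (sw x) x) ?_ ?_ u _ key hu
    · intro x; cases par u <;> simp [sw_sw]
    · intro x hx; cases par u
      · exact hx
      · exact xS_sw hx

theorem Inv_leftS {O : Set (List L)} (hO : Inv O) :
    Inv {v | ∃ x, isS x = true ∧ x :: v ∈ O} := by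
  refine Inv.of_h_any ?_ ?_ ?_
  · rintro w ⟨x, hx, h2⟩
    exact ⟨sw x, xS_sw hx, hO.s _ h2⟩
  · rintro w ⟨x, hx, h2⟩
    exact ⟨ro x, xS_ro hx, hO.r _ h2⟩
  · rintro w ⟨x, hx, h2⟩
    exact ⟨_, x, hx, hO.h _ h2⟩

theorem par_append (u v : List L) : par (u ++ v) = xor (par u) (par v) := by
  induction u with
  | nil => simp [par]
  | cons x u ih => simp [par, ih]

theorem fin_absurd {p1 p2 p3 q1 q2 q3 : Prop} (o1 : p1 ∨ q1) (o2 : p2 ∨ q2) (o3 : p3 ∨ q3)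
    (e1 : p1 ∨ p2 ∨ p3) (e2 : q1 ∨ q2 ∨ q3)
    (n1 : ¬ p1 ∨ ¬ q1) (n2 : ¬ p2 ∨ ¬ q2) (n3 : ¬ p3 ∨ ¬ q3)
    (u1 : ((p1 ∧ ¬ p2 ∧ ¬ p3) ∨ (¬ p1 ∧ p2 ∧ ¬ p3) ∨ (¬ p1 ∧ ¬ p2 ∧ p3)) →
      ((q1 ∧ ¬ q2 ∧ ¬ q3) ∨ (¬ q1 ∧ q2 ∧ ¬ q3) ∨ (¬ q1 ∧ ¬ q2 ∧ q3)))
    (u2 : ((q1 ∧ ¬ q2 ∧ ¬ q3) ∨ (¬ q1 ∧ q2 ∧ ¬ q3) ∨ (¬ q1 ∧ ¬ q2 ∧ q3)) →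
      ((p1 ∧ ¬ p2 ∧ ¬ p3) ∨ (¬ p1 ∧ p2 ∧ ¬ p3) ∨ (¬ p1 ∧ ¬ p2 ∧ p3))) : False := by
  by_cases h1 : p1 <;> by_cases h2 : p2 <;> by_cases h3 : p3 <;> simp_all

theorem P_mid {V : List Bool} (hok : Ok V) (hh : V.head? = some true)
    (hl : V.getLast? = some true) (hp1 : P (true :: false :: (V ++ [false])))
    (hp2 : P (false :: (V ++ [false, true]))) :
    P (true :: false :: (V ++ [false, true])) := by
  obtain ⟨g0, h1, h2, h3, h4, -⟩ := good1 V hok hh hl true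
  obtain ⟨g, rfl⟩ : ∃ g, g = g0 ++ [C] := ⟨_, rfl⟩
  set G := g0 ++ [C] with hG
  have hfix : h false G = G := by rw [hG, h_append, h2, h3]; rfl
  have hpar : par G = true := by rw [hG, par_append, h3]; rfl
  have hhd : ∀ x ∈ G.head?, isS x = true := by
    intro x hx
    rw [← h1] at hh
    simp only [pat, List.head?_map] at hh
    rw [hx] at hh
    simpa using hh
  have hlast : ∀ x ∈ G.getLast?, isS x = true := by
    intro x hx
    rw [← h1] at hl
    simp only [pat, List.getLast?_map] at hl
    rw [hx] at hl
    simpa using hl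
  have redGD : ∀ t : List L, Red (D :: t) → Red (G ++ D :: t) := by
    intro t ht
    refine List.isChain_append.2 ⟨h4, ht, ?_⟩
    intro x hx y hy
    simp only [List.head?_cons, Option.mem_def, Option.some.injEq] at hy
    subst hy
    rintro rfl
    simpa [isS] using hlast _ hx
  have redDG : ∀ t : List L, Red (D :: t) → Red (D :: (G ++ D :: t)) := by
    intro t ht
    refine List.isChain_cons.2 ⟨?_, redGD t ht⟩
    rintro x hx rfl
    have hne : G ≠ [] := by simp [hG]
    rw [List.head?_append_of_ne_nil _ hne] at hx
    simpa [isS] using hhd _ hx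
  simp only [pat] at h1
  intro w w' hw hw' hp hp' O hO hwO
  by_contra hw'O
  have col : ∀ O' : Set (List L), Inv O' → (∃ w ∈ O', Red w ∧
      pat w = true :: false :: (V ++ [false, true])) →
      ∀ y, isS y = true → ∃ x, isS x = true ∧ x :: D :: (G ++ [D, y]) ∈ O' := by
    rintro O' hO' ⟨w, hwO, hw, hp⟩ y hy
    obtain ⟨x, v, rfl, hx, hv⟩ := pat_cons hp
    refine hp2 v (D :: (G ++ [D, y])) hw.tail ?_ hv ?_ _ (Inv_leftS hO') ⟨x, hx, hwO⟩
    · apply redDG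
      cases y <;> simp_all [isS]
    · simp [pat, h1, hy, isS_D]
  have row : ∀ O' : Set (List L), Inv O' → ∀ y, B :: D :: (G ++ [D, y]) ∈ O' →
      A :: D :: (G ++ [D, y]) ∈ O' := by
    intro O' hO' y hy
    have h5 := hO'.s _ (hO'.h _ hy)
    have h6 : h false (B :: D :: (G ++ [D, y])) = B :: D :: (G.map sw ++ [D, sw y]) := by
      have : h true G = G.map sw := by rw [h_true, hfix]
      simp [h, tog, h_append, this, hpar, sw]
    rw [h6] at h5
    simpa [sw_B, sw_D, Function.comp_def, sw_sw] using h5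
  have colO := col O hO ⟨w, hwO, hw, hp⟩
  have colC := col _ hO.compl ⟨w', hw'O, hw', hp'⟩
  have hor : ∀ y, isS y = true → (A :: D :: (G ++ [D, y]) ∈ O ∨ C :: D :: (G ++ [D, y]) ∈ O) := by
    intro y hy
    obtain ⟨x, hx, hxO⟩ := colO y hy
    cases x
    · exact Or.inl hxO
    · exact Or.inl (row O hO y hxO)
    · exact Or.inr hxO
    · simp [isS] at hx
  have hnor : ∀ y, isS y = true →
      (A :: D :: (G ++ [D, y]) ∉ O ∨ C :: D :: (G ++ [D, y]) ∉ O) := by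
    intro y hy
    obtain ⟨x, hx, hxO⟩ := colC y hy
    cases x
    · exact Or.inl hxO
    · exact Or.inl (row _ hO.compl y hxO)
    · exact Or.inr hxO
    · simp [isS] at hx
  have redx : ∀ x, isS x = true → Red (x :: D :: (G ++ [D])) := by
    intro x hx
    refine List.isChain_cons_cons.2 ⟨?_, redDG [] (by simp)⟩
    rintro rfl; simp [isS] at hx
  have patx : ∀ x, isS x = true → pat (x :: D :: (G ++ [D])) = true :: false :: (V ++ [false]) := by
    intro x hx
    simp [pat, h1, hx, isS_D]
  have rowne : ∀ x, isS x = true → (x :: D :: (G ++ [D, A]) ∈ O ∨ x :: D :: (G ++ [D, B]) ∈ O ∨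
      x :: D :: (G ++ [D, C]) ∈ O) := by
    intro x hx
    obtain ⟨v, z, rfl, hz, hv⟩ := pat_concat (V := true :: false :: (V ++ [false])) (i := true)
      (w := w) (by rw [hp]; simp)
    obtain ⟨y, hy, -, hyO⟩ := hp1 v _ hw.left_of_append (redx x hx) hv (patx x hx) _
      (Inv_right hO) ⟨z, hz, hw, hwO⟩
    simp only [List.cons_append, List.append_assoc, List.nil_append] at hyO
    cases y
    · exact Or.inl hyO
    · exact Or.inr (Or.inl hyO)
    · exact Or.inr (Or.inr hyO)
    · simp [isS] at hy
  have e1 := rowne A rfl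
  have e2 := rowne C rfl
  clear rowne
  have u1 := hp1 _ _ (redx A rfl) (redx C rfl) (patx A rfl) (patx C rfl) _ (Inv_unique hO)
  have u2 := hp1 _ _ (redx C rfl) (redx A rfl) (patx C rfl) (patx A rfl) _ (Inv_unique hO)
  simp only [Set.mem_ofPred_eq, List.cons_append, List.append_assoc, List.nil_append] at u1 u2
  generalize hpA : (fun y => A :: D :: (G ++ [D, y]) ∈ O) = p at *
  generalize hpC : (fun y => C :: D :: (G ++ [D, y]) ∈ O) = q at *
  have eA : ∀ y, (A :: D :: (G ++ [D, y]) ∈ O) = p y := fun y => by rw [← hpA]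
  have eC : ∀ y, (C :: D :: (G ++ [D, y]) ∈ O) = q y := fun y => by rw [← hpC]
  simp only [eA, eC] at u1 u2 e1 e2 hor hnor
  rw [fin_unique, fin_unique] at u1 u2
  have o1 := hor A rfl
  have o2 := hor B rfl
  have o3 := hor C rfl
  have n1 := hnor A rfl
  have n2 := hnor B rfl
  have n3 := hnor C rfl
  clear hor hnor eA eC hpA hpC row col colO colC redx patx
  exact fin_absurd o1 o2 o3 e1 e2 n1 n2 n3 u1 u2

theorem P_all : ∀ (n : ℕ) (W : List Bool), W.length = n → Ok W → P W := by
  intro n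
  induction n using Nat.strong_induction_on with
  | _ n ih =>
  intro W hn hok
  have IH : ∀ V : List Bool, V.length < W.length → Ok V → P V :=
    fun V hV hV2 => ih V.length (hn ▸ hV) V rfl hV2
  clear ih hn
  match W, hok, IH with
  | [], _, _ => exact P_nil
  | false :: V, hok, IH => exact P_d (IH V (by simp) hok.tail)
  | [true], _, _ => exact P_one
  | true :: true :: V, hok, IH => exact P_left hok.tail.tail (IH _ (by simp) hok.tail)
  | true :: false :: T, hok, IH =>
    rcases List.eq_nil_or_concat' T with rfl | ⟨T1, z, rfl⟩
    · exact P_d' (V := [true]) P_one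
    cases z with
    | false =>
      refine P_d' (V := true :: false :: T1) (IH _ (by simp) ?_)
      exact List.IsChain.left_of_append (l₁ := true :: false :: T1) hok
    | true =>
      rcases List.eq_nil_or_concat' T1 with rfl | ⟨T2, y, rfl⟩
      · exact P_sds
      have hokl : Ok (true :: false :: (T2 ++ [y])) :=
        List.IsChain.left_of_append (l₁ := true :: false :: (T2 ++ [y])) hok
      cases y with
      | true =>
        refine P_right (V := true :: false :: (T2 ++ [true])) hokl rfl ?_ (IH _ (by simp) hokl)
        rw [← List.cons_append, ← List.cons_append, List.getLast?_concat]
      | false =>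
        have hok2 : Ok T2 := (hokl.tail.tail).left_of_append
        have hne : T2 ≠ [] := by
          rintro rfl
          simp [Ok] at hokl
        have hh : T2.head? = some true := by
          cases T2 with
          | nil => simp at hne
          | cons x T2 =>
            have := (List.isChain_cons_cons.1 hokl.tail).1
            simpa using this
        have hl : T2.getLast? = some true := by
          rcases List.eq_nil_or_concat' T2 with rfl | ⟨T3, x, rfl⟩
          · simp at hne
          · have h3 := hokl.tail.tail
            simp only [List.tail_cons, List.append_assoc] at h3
            have := h3.right_of_append
            simpa using this
        have e : T2 ++ [false] ++ [true] = T2 ++ [false, true] := by simp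
        rw [e] at hok IH ⊢
        exact P_mid hok2 hh hl (IH _ (by simp) hokl) (IH _ (by simp) hok.tail)

theorem ok_pat (w : List L) (hw : Red w) : Ok (pat w) := by
  rw [Ok, pat, List.isChain_map]
  refine hw.imp ?_
  intro x y hxy
  cases x <;> cases y <;> simp_all [isS]

theorem trans_all (w w' : List L) (hw : Red w) (hw' : Red w') (hp : pat w = pat w')
    (O : Set (List L)) (hO : Inv O) (hwO : w ∈ O) : w' ∈ O :=
  P_all _ _ rfl (ok_pat w hw) w w' hw hw' rfl hp.symm O hO hwO

/-- Some word in any orbit of words with a star is active at the root. -/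
theorem exists_odd (w : List L) (hw : Red w) (hs : ∃ x ∈ w, isS x = true)
    (O : Set (List L)) (hO : Inv O) (hwO : w ∈ O) : ∃ w' ∈ O, par w' = true := by
  have tailA : ∀ t : List L, Red t → ∃ t', Red t' ∧ pat t' = pat t ∧ t'.head? ≠ some B ∧
      t'.head? ≠ some C := by
    intro t ht
    cases t with
    | nil => exact ⟨[], ht, rfl, by simp, by simp⟩
    | cons y t =>
      cases y
      · exact ⟨_, ht, rfl, by simp, by simp⟩
      · exact ⟨_, red_map sw sw_sw _ ht, pat_sw _, by simp [sw], by simp [sw]⟩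
      · exact ⟨_, red_map sw sw_sw _ (red_map ro ro_ro _ ht), (pat_sw _).trans (pat_ro _),
          by simp [sw, ro], by simp [sw, ro]⟩
      · exact ⟨_, ht, rfl, by simp, by simp⟩
  have main : ∀ (pre : List L) (x : L) (t : List L), (pre = [] ∨ pre = [D]) → isS x = true →
      Red (pre ++ x :: t) → pre ++ x :: t ∈ O → ∃ w' ∈ O, par w' = true := by
    intro pre x t hpre hx hr hm
    obtain ⟨t', h1, h2, h3, h4⟩ := tailA t hr.right_of_append.tail
    have hB : Red (B :: t') := List.isChain_cons.2 ⟨by rintro y hy rfl; exact h3 hy, h1⟩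
    have hC : Red (C :: t') := List.isChain_cons.2 ⟨by rintro y hy rfl; exact h4 hy, h1⟩
    have hB' : Red (pre ++ B :: t') := by
      rcases hpre with rfl | rfl
      · exact hB
      · exact List.isChain_cons_cons.2 ⟨by simp, hB⟩
    have hC' : Red (pre ++ C :: t') := by
      rcases hpre with rfl | rfl
      · exact hC
      · exact List.isChain_cons_cons.2 ⟨by simp, hC⟩
    simp only [pat] at h2
    have mB := trans_all _ _ hr hB' (by simp [pat, h2, hx, isS_B, isS_C]) O hO hm
    have mC := trans_all _ _ hr hC' (by simp [pat, h2, hx, isS_B, isS_C]) O hO hm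
    cases hpar : par (pre ++ B :: t') with
    | true => exact ⟨_, mB, hpar⟩
    | false =>
      refine ⟨_, mC, ?_⟩
      simp only [par_append, par, tog] at hpar ⊢
      revert hpar
      cases par pre <;> cases par t' <;> simp
  match w, hw, hs, hwO with
  | [], _, hs, _ => simp at hs
  | D :: [], _, hs, _ => simp [isS] at hs
  | D :: D :: t, hw, _, _ => simp [Red] at hw
  | D :: A :: t, hw, _, hwO => exact main [D] A t (Or.inr rfl) rfl hw hwO
  | D :: B :: t, hw, _, hwO => exact main [D] B t (Or.inr rfl) rfl hw hwO
  | D :: C :: t, hw, _, hwO => exact main [D] C t (Or.inr rfl) rfl hw hwO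
  | A :: t, hw, _, hwO => exact main [] A t (Or.inl rfl) rfl hw hwO
  | B :: t, hw, _, hwO => exact main [] B t (Or.inl rfl) rfl hw hwO
  | C :: t, hw, _, hwO => exact main [] C t (Or.inl rfl) rfl hw hwO

/-! The action on the tree. -/

/-- Sections of the letters. -/
def sec : L → Bool → L
  | A, false => B
  | A, true => C
  | B, false => C
  | B, true => B
  | C, _ => A
  | D, _ => D

def X : L → List Bool → List Bool
  | _, [] => []
  | x, i :: u => xor (tog x) i :: X (sec x i) u

def act : List L → List Bool → List Bool
  | [], u => u
  | x :: w, u => act w (X x u)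

/-- The dual automaton. -/
def st : Bool → List L → List L
  | _, [] => []
  | i, x :: w => sec x i :: st (xor (tog x) i) w

theorem X_X (x : L) (u : List Bool) : X x (X x u) = u := by
  induction u generalizing x with
  | nil => rfl
  | cons i u ih =>
    have h1 : sec x (xor (tog x) i) = sec x i := by cases x <;> cases i <;> rfl
    simp [X, h1, ih]

theorem act_cons (w : List L) (i : Bool) (u : List Bool) :
    act w (i :: u) = xor (par w) i :: act (st i w) u := by
  induction w generalizing i u with
  | nil => simp [act, st, par]
  | cons x w ih =>
    simp only [act, X, st, par, ih]
    congr 1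
    cases tog x <;> cases par w <;> cases i <;> rfl

theorem length_st (w : List L) (i : Bool) : (st i w).length = w.length := by
  induction w generalizing i with
  | nil => rfl
  | cons x w ih => simp [st, ih]

theorem st_inj (w w' : List L) (i : Bool) (hw : st i w = st i w') : w = w' := by
  induction w generalizing i w' with
  | nil => cases w' with
    | nil => rfl
    | cons y w' => simp [st] at hw
  | cons x w ih => cases w' with
    | nil => simp [st] at hw
    | cons y w' =>
      simp only [st, List.cons.injEq] at hw
      have hxy : x = y := by
        have := hw.1
        revert this
        cases x <;> cases y <;> cases i <;> simp [sec]
      subst hxy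
      rw [ih _ _ hw.2]

theorem st_ro (w : List L) (i : Bool) : st (!i) w = (st i w).map ro := by
  induction w generalizing i with
  | nil => rfl
  | cons x w ih =>
    simp only [st, List.map_cons]
    rw [← ih]
    congr 1
    · cases x <;> cases i <;> rfl
    · congr 1; cases x <;> cases i <;> rfl

theorem st_sw (w : List L) (i : Bool) : st (!i) (w.map sw) = st i w := by
  induction w generalizing i with
  | nil => rfl
  | cons x w ih =>
    simp only [st, List.map_cons]
    rw [← ih]
    congr 1
    · cases x <;> cases i <;> rfl
    · congr 1; cases x <;> cases i <;> rfl

theorem h_st (w : List L) (e : Bool) :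
    h e w = (((st (!e) w).map sw).map ro).map sw := by
  induction w generalizing e with
  | nil => rfl
  | cons x w ih =>
    simp only [st, List.map_cons, h, ih]
    congr 1
    · cases x <;> cases e <;> rfl
    · congr 4; cases x <;> cases e <;> rfl

def triv : Set (List L) := {w | ∀ u, act w u = u}

theorem triv_st (w : List L) (i : Bool) (hw : w ∈ triv) : st i w ∈ triv := by
  intro u
  have := hw (i :: u)
  rw [act_cons] at this
  exact (List.cons.inj this).2

theorem triv_par (w : List L) (hw : w ∈ triv) : par w = false := by
  have := hw [false]
  rw [act_cons] at this
  simpa using (List.cons.inj this).1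

theorem triv_surj (w : List L) (i : Bool) (hw : w ∈ triv) : ∃ v ∈ triv, st i v = w := by
  have hfin : ({v | v ∈ triv ∧ v.length = w.length} : Set (List L)).Finite :=
    (List.finite_length_eq L w.length).subset fun v hv => hv.2
  have hmaps : Set.MapsTo (st i) {v | v ∈ triv ∧ v.length = w.length}
      {v | v ∈ triv ∧ v.length = w.length} :=
    fun v hv => ⟨triv_st v i hv.1, by rw [length_st, hv.2]⟩
  have hinj : Set.InjOn (st i) {v | v ∈ triv ∧ v.length = w.length} :=
    fun v _ v' _ hvv => st_inj v v' i hvv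
  obtain ⟨v, hv, hvw⟩ := (hfin.injOn_iff_bijOn_of_mapsTo hmaps).1 hinj |>.surjOn ⟨hw, rfl⟩
  exact ⟨v, hv.1, hvw⟩

theorem triv_of_st (w : List L) (i : Bool) (hw : st i w ∈ triv) : w ∈ triv := by
  obtain ⟨v, hv, hvw⟩ := triv_surj _ i hw
  rwa [← st_inj v w i hvw]

theorem Inv_triv : Inv triv := by
  have hs : ∀ w ∈ triv, w.map sw ∈ triv := by
    intro w hw
    apply triv_of_st _ (!false)
    rw [st_sw]
    exact triv_st w _ hw
  have hr : ∀ w ∈ triv, w.map ro ∈ triv := by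
    intro w hw
    obtain ⟨v, hv, rfl⟩ := triv_surj w false hw
    rw [← st_ro]
    exact triv_st v _ hv
  refine ⟨hs, hr, fun w hw => ?_⟩
  rw [h_st]
  exact hs _ (hr _ (hs _ (triv_st w _ hw)))

theorem not_triv (w : List L) (hw : Red w) (hs : ∃ x ∈ w, isS x = true) : w ∉ triv := by
  intro hwt
  obtain ⟨w', h1, h2⟩ := exists_odd w hw hs triv Inv_triv hwt
  rw [triv_par w' h1] at h2
  simp at h2

/-! Translation of reduced words of the free group. -/

def emb : Fin 3 → L := ![A, B, C]

def conv : Bool → List (Fin 3 × Bool) → List L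
  | false, [] => []
  | true, [] => [D]
  | false, (x, true) :: l => D :: emb x :: conv false l
  | true, (x, true) :: l => emb x :: conv false l
  | false, (x, false) :: l => emb x :: conv true l
  | true, (x, false) :: l => D :: emb x :: conv true l

theorem emb_ne (x : Fin 3) : emb x ≠ D := by revert x; decide
theorem emb_S (x : Fin 3) : isS (emb x) = true := by revert x; decide
theorem emb_inj (x y : Fin 3) (hxy : emb x = emb y) : x = y := by revert x y; decide

theorem red_conv (l : List (Fin 3 × Bool)) (x : Fin 3) (i : Bool)
    (hl : FreeGroup.IsReduced ((x, i) :: l)) : Red (emb x :: conv (!i) l) := by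
  induction l generalizing x i with
  | nil => cases i <;> simp [conv, Red, emb_ne]
  | cons y l ih =>
    obtain ⟨y, j⟩ := y
    replace hl := List.isChain_cons_cons.1 hl
    have h1 := ih y j hl.2
    have h2 := hl.1
    simp only at h2
    have h3 : i ≠ j → emb x ≠ emb y := fun hij he => hij (h2 (emb_inj x y he))
    cases i <;> cases j
    · exact List.isChain_cons_cons.2 ⟨emb_ne x, List.isChain_cons_cons.2 ⟨(emb_ne y).symm, h1⟩⟩
    · exact List.isChain_cons_cons.2 ⟨h3 (by simp), h1⟩
    · exact List.isChain_cons_cons.2 ⟨h3 (by simp), h1⟩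
    · exact List.isChain_cons_cons.2 ⟨emb_ne x, List.isChain_cons_cons.2 ⟨(emb_ne y).symm, h1⟩⟩

theorem aut_act (q : Fin 3) (u : List Bool) : A2240.act q u = X D (X (emb q) u) := by
  induction u generalizing q with
  | nil => rfl
  | cons i u ih =>
    simp only [BinAutomaton.act, X, ih]
    fin_cases q <;> cases i <;> rfl

noncomputable def gen : Fin 3 → Equiv.Perm (List Bool) := ![a, b, c]

theorem gen_eq (q : Fin 3) : gen q = A2240.perm q := by fin_cases q <;> rfl

theorem gen_apply (q : Fin 3) (u : List Bool) : gen q u = X D (X (emb q) u) := by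
  rw [gen_eq, ← aut_act]; rfl

theorem gen_inv_apply (q : Fin 3) (u : List Bool) : (gen q)⁻¹ u = X (emb q) (X D u) := by
  rw [Equiv.Perm.inv_eq_iff_eq, gen_apply, X_X, X_X]

theorem act_conv (l : List (Fin 3 × Bool)) (e : Bool) (u : List Bool) :
    act (conv e l) u =
      ((l.map fun x => cond x.2 (gen x.1) (gen x.1)⁻¹).prod)⁻¹ (cond e (X D u) u) := by
  induction l generalizing e u with
  | nil => cases e <;> simp [conv, act]
  | cons y l ih =>
    obtain ⟨x, j⟩ := y
    simp only [List.map_cons, List.prod_cons, mul_inv_rev, Equiv.Perm.mul_apply]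
    cases e <;> cases j <;> simp [conv, act, ih, gen_apply, gen_inv_apply, X_X]

theorem lift_inj : Function.Injective (FreeGroup.lift gen) := by
  rw [injective_iff_map_eq_one]
  intro g hg
  rw [← FreeGroup.toWord_eq_nil_iff]
  have hred : FreeGroup.IsReduced g.toWord := FreeGroup.isReduced_toWord
  rw [← FreeGroup.mk_toWord (x := g), FreeGroup.lift_mk] at hg
  by_contra hne
  have ht : conv false g.toWord ∈ triv := by
    intro u
    rw [act_conv, hg]
    simp
  revert hne hred ht
  generalize g.toWord = l
  intro hred ht hne
  match l, hred, ht, hne with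
  | [], _, hne, _ => exact hne rfl
  | (x, true) :: l, hred, _, ht =>
    refine not_triv _ ?_ ⟨emb x, ?_, emb_S x⟩ ht
    · exact List.isChain_cons_cons.2 ⟨(emb_ne x).symm, red_conv l x true hred⟩
    · simp [conv]
  | (x, false) :: l, hred, _, ht =>
    refine not_triv _ ?_ ⟨emb x, ?_, emb_S x⟩ ht
    · exact red_conv l x false hred
    · simp [conv]

end AV

/-- The group generated by the Aleshin–Vorobets automaton is a free group of
rank 3 with free basis `{a, b, c}`: the homomorphism from the free group on
three generators sending the generators to `a`, `b`, `c` is injective, and its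
range is the group generated by `a`, `b`, `c`. -/
theorem aleshin_vorobets_generates_free_group_of_rank_three :
    Function.Injective
      ⇑(FreeGroup.lift (![a, b, c] : Fin 3 → Equiv.Perm (List Bool))) ∧
    (FreeGroup.lift ![a, b, c]).range = Subgroup.closure {a, b, c} := by
  refine ⟨AV.lift_inj, ?_⟩
  rw [FreeGroup.range_lift_eq_closure]
  congr 1
  ext x
  simp
  tauto
end
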